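/- arXiv:1807.11609 — 2 statements merged into one kernel-verified Lean document; each statement's English description precedes it below -/
import Mathlib

section
/- Fix a positive integer m and a binary string x ∈ {0,1}^m. The normalized random variable X_n := (Ω_n(x) − E[Ω_n(x)])/√(Var[Ω_n(x)]) converges in distribution to a standard normal random variable as n → ∞; that is, for every bounded continuous function f : ℝ → ℝ, E[f(X_n)] converges to the integral of f against the standard Gaussian measure N(0,1) on ℝ. -/
open Filter Asymptotics

/-- `ω_x(y)`: the number of ways the string `x` of length `m` can be embedded as a
subsequence of the string `y` of length `n`, i.e. the number of strictly increasing
index maps `π : Fin m → Fin n` with `y ∘ π = x`. -/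
noncomputable def omega {m n : ℕ} (x : Fin m → Bool) (y : Fin n → Bool) : ℕ :=
  Nat.card {π : Fin m → Fin n // StrictMono π ∧ ∀ j, y (π j) = x j}

/-- Expectation of `f` under the uniform distribution on `{0,1}^n`. -/
noncomputable def expectUnif (n : ℕ) (f : (Fin n → Bool) → ℝ) : ℝ :=
  (∑ y : Fin n → Bool, f y) / 2 ^ n

/-- Variance of `f` under the uniform distribution on `{0,1}^n`. -/
noncomputable def varUnif (n : ℕ) (f : (Fin n → Bool) → ℝ) : ℝ :=
  expectUnif n (fun y => (f y - expectUnif n f) ^ 2)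

section CentralLimit

open MeasureTheory ProbabilityTheory Topology Finset

/-- The sign `±1` attached to a bit. -/
def bitSign (b : Bool) : ℝ := if b then 1 else -1

/-- The Walsh function indexed by a set of coordinates. -/
def walsh {n : ℕ} (T : Finset (Fin n)) (y : Fin n → Bool) : ℝ := ∏ i ∈ T, bitSign (y i)

lemma sum_prod_coord {R : Type*} [CommSemiring R] {n : ℕ} (f : Fin n → Bool → R) :
    ∑ y : Fin n → Bool, ∏ i, f i (y i) = ∏ i, ∑ b, f i b := by
  rw [Finset.prod_univ_sum, Fintype.piFinset_univ]

/-! ### Linearity and monotonicity of the uniform expectation -/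

lemma expectUnif_const (n : ℕ) (c : ℝ) : expectUnif n (fun _ => c) = c := by
  simp [expectUnif]

lemma expectUnif_add (n : ℕ) (f g : (Fin n → Bool) → ℝ) :
    expectUnif n (fun y => f y + g y) = expectUnif n f + expectUnif n g := by
  simp [expectUnif, Finset.sum_add_distrib, add_div]

lemma expectUnif_const_mul (n : ℕ) (c : ℝ) (f : (Fin n → Bool) → ℝ) :
    expectUnif n (fun y => c * f y) = c * expectUnif n f := by
  simp [expectUnif, ← Finset.mul_sum, mul_div_assoc]

lemma expectUnif_sum (n : ℕ) {ι : Type*} (s : Finset ι) (f : ι → (Fin n → Bool) → ℝ) :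
    expectUnif n (fun y => ∑ i ∈ s, f i y) = ∑ i ∈ s, expectUnif n (f i) := by
  simp only [expectUnif, ← Finset.sum_div]
  rw [Finset.sum_comm]

lemma expectUnif_sq_nonneg (n : ℕ) (f : (Fin n → Bool) → ℝ) :
    0 ≤ expectUnif n (fun y => f y ^ 2) :=
  div_nonneg (Finset.sum_nonneg fun _ _ => sq_nonneg _) (by positivity)

lemma expectUnif_abs_le_sqrt (n : ℕ) (f : (Fin n → Bool) → ℝ) :
    expectUnif n (fun y => |f y|) ≤ √(expectUnif n (fun y => f y ^ 2)) := by
  apply Real.le_sqrt_of_sq_le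
  have h := sq_sum_le_card_mul_sum_sq (s := (Finset.univ : Finset (Fin n → Bool)))
    (f := fun y => |f y|)
  simp only [sq_abs, Finset.card_univ, Fintype.card_pi, Fintype.card_bool, Finset.prod_const,
    Fintype.card_fin, Nat.cast_pow, Nat.cast_ofNat] at h
  unfold expectUnif
  rw [div_pow, div_le_div_iff₀ (by positivity) (by positivity)]
  calc _ ≤ (2 ^ n * ∑ y, f y ^ 2) * 2 ^ n := by gcongr
    _ = _ := by ring

/-! ### Orthonormality of the Walsh functions -/

lemma expectUnif_walsh_mul_walsh {n : ℕ} (S T : Finset (Fin n)) :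
    expectUnif n (fun y => walsh S y * walsh T y) = if S = T then 1 else 0 := by
  have h1 : ∀ y : Fin n → Bool, walsh S y * walsh T y =
      ∏ i, ((if i ∈ S then bitSign (y i) else 1) * (if i ∈ T then bitSign (y i) else 1)) := by
    intro y
    rw [Finset.prod_mul_distrib, Finset.prod_ite_mem, Finset.prod_ite_mem]
    simp [walsh]
  have h2 : ∀ i, ∑ b, ((if i ∈ S then bitSign b else 1) * (if i ∈ T then bitSign b else 1)) =
      if (i ∈ S ↔ i ∈ T) then 2 else 0 := by
    intro i
    by_cases hS : i ∈ S <;> by_cases hT : i ∈ T <;> simp [hS, hT, bitSign]; norm_num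
  simp only [expectUnif, h1]
  rw [sum_prod_coord (fun i b => (if i ∈ S then bitSign b else 1) *
    (if i ∈ T then bitSign b else 1))]
  simp only [h2]
  by_cases h : S = T
  · subst h; simp
  · rw [if_neg h]
    obtain ⟨i, hi⟩ : ∃ i, ¬ (i ∈ S ↔ i ∈ T) := by
      by_contra! hc
      exact h (Finset.ext hc)
    rw [Finset.prod_eq_zero (Finset.mem_univ i) (by simp [hi]), zero_div]

/-! ### Lévy's continuity theorem for functions of uniform strings -/

lemma tendsto_expectUnif_of_tendsto_charFun (X : ∀ n, (Fin n → Bool) → ℝ)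
    (h : ∀ t : ℝ, Tendsto (fun n => (∑ y, Complex.exp (t * X n y * Complex.I)) / 2 ^ n) atTop
      (𝓝 (Complex.exp (-(t ^ 2 / 2)))))
    (f : BoundedContinuousFunction ℝ ℝ) :
    Tendsto (fun n => expectUnif n (fun y => f (X n y))) atTop
      (𝓝 (∫ t, f t ∂(gaussianReal 0 1))) := by
  let μ : ∀ n, Measure (Fin n → Bool) := fun n => (PMF.uniformOfFintype (Fin n → Bool)).toMeasure
  have hX : ∀ n, Measurable (X n) := fun n => measurable_of_finite _
  let ν : ℕ → ProbabilityMeasure ℝ := fun n =>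
    ⟨(μ n).map (X n), Measure.isProbabilityMeasure_map (hX n).aemeasurable⟩
  let γ : ProbabilityMeasure ℝ := ⟨gaussianReal 0 1, inferInstance⟩
  have hν : Tendsto ν atTop (𝓝 γ) := by
    refine ProbabilityMeasure.tendsto_iff_tendsto_charFun.2 fun t => ?_
    have h2 : charFun (γ : Measure ℝ) t = Complex.exp (-(t ^ 2 / 2)) := by
      change charFun (gaussianReal 0 1) t = _
      rw [charFun_gaussianReal]
      simp
    rw [h2]
    refine (h t).congr fun n => ?_
    change _ = charFun ((μ n).map (X n)) t
    rw [charFun_apply_real, integral_map (hX n).aemeasurable (by fun_prop), PMF.integral_eq_sum]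
    simp [← Finset.mul_sum, div_eq_inv_mul]
  have := (ProbabilityMeasure.tendsto_iff_forall_integral_tendsto.1 hν) f
  refine this.congr fun n => ?_
  change ∫ ω, f ω ∂((μ n).map (X n)) = _
  rw [integral_map (hX n).aemeasurable (by fun_prop), PMF.integral_eq_sum]
  simp [expectUnif, ← Finset.mul_sum, div_eq_inv_mul]

/-! ### Estimates for products of cosines -/

lemma abs_cos_sub_exp_le (u : ℝ) : |Real.cos u - Real.exp (-(u ^ 2 / 2))| ≤ 2 * u ^ 4 := by
  have he1 : Real.exp (-(u ^ 2 / 2)) ≤ 1 := Real.exp_le_one_iff.2 (by nlinarith [sq_nonneg u])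
  have he0 := Real.exp_pos (-(u ^ 2 / 2))
  rcases le_total |u| 1 with hu | hu
  · have h1 := Real.cos_bound hu
    have h4 : |u| ^ 4 = u ^ 4 := by rw [show 4 = 2 * 2 from rfl, pow_mul, sq_abs, ← pow_mul]
    rw [h4] at h1
    have h2 : |(-(u ^ 2 / 2))| ≤ 1 := by
      rw [abs_neg, abs_of_nonneg (by positivity)]
      nlinarith [sq_abs u, abs_nonneg u]
    have h3 := Real.abs_exp_sub_one_sub_id_le h2
    have h5 : (-(u ^ 2 / 2)) ^ 2 = u ^ 4 / 4 := by ring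
    rw [h5] at h3
    rw [abs_le] at *
    have : 0 ≤ u ^ 4 := by positivity
    constructor <;> linarith
  · have h1 : 1 ≤ u ^ 4 := by
      have : 1 ≤ u ^ 2 := by nlinarith [sq_abs u]
      nlinarith
    rw [abs_le]
    constructor <;> linarith [Real.cos_le_one u, Real.neg_one_le_cos u]

lemma abs_prod_sub_prod_le {ι : Type*} (s : Finset ι) (f g : ι → ℝ) (hf : ∀ i, |f i| ≤ 1)
    (hg : ∀ i, |g i| ≤ 1) : |∏ i ∈ s, f i - ∏ i ∈ s, g i| ≤ ∑ i ∈ s, |f i - g i| := by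
  classical
  induction s using Finset.induction_on with
  | empty => simp
  | insert a s ha ih =>
    rw [Finset.prod_insert ha, Finset.prod_insert ha, Finset.sum_insert ha]
    have h1 : |∏ i ∈ s, g i| ≤ 1 := by
      rw [Finset.abs_prod]
      exact Finset.prod_le_one (fun _ _ => abs_nonneg _) fun i _ => hg i
    calc |f a * ∏ i ∈ s, f i - g a * ∏ i ∈ s, g i|
        = |f a * (∏ i ∈ s, f i - ∏ i ∈ s, g i) + (f a - g a) * ∏ i ∈ s, g i| := by ring_nf
      _ ≤ |f a| * |∏ i ∈ s, f i - ∏ i ∈ s, g i| + |f a - g a| * |∏ i ∈ s, g i| := by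
        rw [← abs_mul, ← abs_mul]; exact abs_add_le _ _
      _ ≤ 1 * |∏ i ∈ s, f i - ∏ i ∈ s, g i| + |f a - g a| * 1 := by
        gcongr
        exact hf a
      _ ≤ _ := by linarith

lemma abs_prod_cos_sub_exp_le {ι : Type*} (s : Finset ι) (u : ι → ℝ) :
    |∏ i ∈ s, Real.cos (u i) - Real.exp (-(∑ i ∈ s, u i ^ 2) / 2)| ≤ 2 * ∑ i ∈ s, u i ^ 4 := by
  have h : Real.exp (-(∑ i ∈ s, u i ^ 2) / 2) = ∏ i ∈ s, Real.exp (-(u i ^ 2 / 2)) := by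
    rw [← Real.exp_sum, Finset.sum_neg_distrib, ← Finset.sum_div, neg_div]
  rw [h, Finset.mul_sum]
  refine (abs_prod_sub_prod_le s _ _ (fun i => Real.abs_cos_le_one _) fun i => ?_).trans
    (Finset.sum_le_sum fun i _ => abs_cos_sub_exp_le _)
  rw [abs_of_pos (Real.exp_pos _)]
  exact Real.exp_le_one_iff.2 (by nlinarith [sq_nonneg (u i)])

lemma abs_exp_neg_sub_exp_neg_le {a b : ℝ} (ha : 0 ≤ a) (hab : a ≤ b) :
    |Real.exp (-a) - Real.exp (-b)| ≤ b - a := by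
  have h1 : Real.exp (-b) = Real.exp (-a) * Real.exp (-(b - a)) := by
    rw [← Real.exp_add]; ring_nf
  have h2 := Real.add_one_le_exp (-(b - a))
  have h3 : Real.exp (-(b - a)) ≤ 1 := Real.exp_le_one_iff.2 (by linarith)
  have h4 : Real.exp (-a) ≤ 1 := Real.exp_le_one_iff.2 (by linarith)
  have h5 := Real.exp_pos (-a)
  rw [h1, abs_of_nonneg (by nlinarith)]
  nlinarith

lemma sum_exp_linear {n : ℕ} (u : Fin n → ℝ) :
    (∑ y : Fin n → Bool, Complex.exp (((∑ i, u i * bitSign (y i) : ℝ) : ℂ) * Complex.I)) / 2 ^ n =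
      ((∏ i, Real.cos (u i) : ℝ) : ℂ) := by
  have h1 : ∀ y : Fin n → Bool,
      Complex.exp (((∑ i, u i * bitSign (y i) : ℝ) : ℂ) * Complex.I) =
        ∏ i, Complex.exp (((u i * bitSign (y i) : ℝ) : ℂ) * Complex.I) := by
    intro y
    rw [← Complex.exp_sum]
    push_cast
    rw [Finset.sum_mul]
  simp only [h1]
  rw [sum_prod_coord (fun i b => Complex.exp (((u i * bitSign b : ℝ) : ℂ) * Complex.I))]
  have h2 : ∀ i, ∑ b, Complex.exp (((u i * bitSign b : ℝ) : ℂ) * Complex.I) =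
      2 * (Real.cos (u i) : ℂ) := by
    intro i
    rw [Complex.ofReal_cos, Complex.two_cos]
    simp [bitSign]
  simp only [h2, Finset.prod_mul_distrib]
  simp

/-! ### Functions with a dominating linear part -/

lemma expectUnif_linear_mul {n : ℕ} (a : Fin n → ℝ) (g : (Fin n → Bool) → ℝ) :
    expectUnif n (fun y => (∑ i, a i * bitSign (y i)) * g y) =
      ∑ i, a i * expectUnif n (fun y => bitSign (y i) * g y) := by
  simp only [Finset.sum_mul, mul_assoc]
  rw [expectUnif_sum]
  simp only [expectUnif_const_mul]

lemma expectUnif_bitSign_mul_bitSign {n : ℕ} (i j : Fin n) :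
    expectUnif n (fun y => bitSign (y i) * bitSign (y j)) = if i = j then 1 else 0 := by
  simpa [walsh] using expectUnif_walsh_mul_walsh {i} {j}

lemma expectUnif_bitSign {n : ℕ} (i : Fin n) : expectUnif n (fun y => bitSign (y i)) = 0 := by
  simpa [walsh] using expectUnif_walsh_mul_walsh {i} ∅

lemma expectUnif_bitSign_mul_linear {n : ℕ} (a : Fin n → ℝ) (i : Fin n) :
    expectUnif n (fun y => bitSign (y i) * ∑ j, a j * bitSign (y j)) = a i := by
  simp only [mul_comm (bitSign _) (∑ _, _)]
  rw [expectUnif_linear_mul]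
  simp [expectUnif_bitSign_mul_bitSign]

lemma expectUnif_linear {n : ℕ} (a : Fin n → ℝ) :
    expectUnif n (fun y => ∑ i, a i * bitSign (y i)) = 0 := by
  simpa [expectUnif_bitSign] using expectUnif_linear_mul a (fun _ => 1)

lemma expectUnif_of_decomposition {n : ℕ} {F R : (Fin n → Bool) → ℝ} {c : ℝ} {a : Fin n → ℝ}
    (hF : ∀ y, F y = c + ∑ i, a i * bitSign (y i) + R y) (hR : expectUnif n R = 0) :
    expectUnif n F = c := by
  rw [funext hF, expectUnif_add, expectUnif_add, expectUnif_const, expectUnif_linear, hR]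
  ring

lemma varUnif_of_decomposition {n : ℕ} {F R : (Fin n → Bool) → ℝ} {c : ℝ} {a : Fin n → ℝ}
    (hF : ∀ y, F y = c + ∑ i, a i * bitSign (y i) + R y) (hR : expectUnif n R = 0)
    (hRi : ∀ i, expectUnif n (fun y => bitSign (y i) * R y) = 0) :
    varUnif n F = ∑ i, a i ^ 2 + expectUnif n (fun y => R y ^ 2) := by
  unfold varUnif
  rw [expectUnif_of_decomposition hF hR]
  have h : ∀ y, (F y - c) ^ 2 = (∑ i, a i * bitSign (y i)) * (∑ i, a i * bitSign (y i)) +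
      2 * ((∑ i, a i * bitSign (y i)) * R y) + R y ^ 2 := by
    intro y
    rw [hF]
    ring
  rw [funext h, expectUnif_add, expectUnif_add, expectUnif_const_mul, expectUnif_linear_mul,
    expectUnif_linear_mul]
  simp [hRi, expectUnif_bitSign_mul_linear, sq]

lemma norm_charFun_sub_linear_le {n : ℕ} (L D : (Fin n → Bool) → ℝ) :
    ‖(∑ y, Complex.exp (((L y + D y : ℝ) : ℂ) * Complex.I)) / 2 ^ n -
      (∑ y, Complex.exp ((L y : ℂ) * Complex.I)) / 2 ^ n‖ ≤ expectUnif n (fun y => |D y|) := by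
  rw [← sub_div, ← Finset.sum_sub_distrib, norm_div]
  unfold expectUnif
  simp only [norm_pow, Complex.norm_ofNat]
  gcongr
  refine (norm_sum_le _ _).trans (Finset.sum_le_sum fun y _ => ?_)
  have h : Complex.exp (((L y + D y : ℝ) : ℂ) * Complex.I) - Complex.exp ((L y : ℂ) * Complex.I) =
      Complex.exp ((L y : ℂ) * Complex.I) * (Complex.exp (Complex.I * D y) - 1) := by
    rw [mul_sub, ← Complex.exp_add]
    push_cast
    ring_nf
  rw [h, norm_mul, Complex.norm_exp_ofReal_mul_I, one_mul]
  exact Real.norm_exp_I_mul_ofReal_sub_one_le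

lemma norm_charFun_sub_gaussian_le {n : ℕ} {F R : (Fin n → Bool) → ℝ} {c ε : ℝ}
    {a : Fin n → ℝ} (hF : ∀ y, F y = c + ∑ i, a i * bitSign (y i) + R y)
    (hR : expectUnif n R = 0) (hRi : ∀ i, expectUnif n (fun y => bitSign (y i) * R y) = 0)
    (hA : 0 < ∑ i, a i ^ 2) (hε : 0 ≤ ε)
    (hB : expectUnif n (fun y => R y ^ 2) ≤ ε * ∑ i, a i ^ 2)
    (hM : ∀ i, a i ^ 2 ≤ ε * ∑ i, a i ^ 2) (t : ℝ) :
    ‖(∑ y, Complex.exp (t * ((F y - expectUnif n F) / √(varUnif n F) : ℝ) * Complex.I)) / 2 ^ n -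
      Complex.exp (-(t ^ 2 / 2))‖ ≤ |t| * √ε + 2 * t ^ 4 * ε + t ^ 2 / 2 * ε := by
  rw [expectUnif_of_decomposition hF hR, varUnif_of_decomposition hF hR hRi]
  have hB0 := expectUnif_sq_nonneg n R
  set A := ∑ i, a i ^ 2 with hAdef
  set B := expectUnif n (fun y => R y ^ 2) with hBdef
  have hV : 0 < A + B := by linarith
  set σ := √(A + B) with hσ
  have hσ0 : 0 < σ := Real.sqrt_pos.2 hV
  have hσ2 : σ ^ 2 = A + B := Real.sq_sqrt hV.le
  have hrat : B / (A + B) ≤ ε := by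
    rw [div_le_iff₀ hV]
    nlinarith
  set u : Fin n → ℝ := fun i => t * a i / σ with hu
  have h1 := norm_charFun_sub_linear_le (fun y => ∑ i, u i * bitSign (y i))
    (fun y => t / σ * R y)
  rw [sum_exp_linear] at h1
  have hsum : ∀ y, (∑ i, u i * bitSign (y i)) + t / σ * R y = t * ((F y - c) / σ) := by
    intro y
    have : ∑ i, u i * bitSign (y i) = t / σ * ∑ i, a i * bitSign (y i) := by
      rw [Finset.mul_sum]
      exact Finset.sum_congr rfl fun i _ => by simp only [hu]; ring
    rw [this, hF]
    ring
  simp only [hsum] at h1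
  have h2 : expectUnif n (fun y => |t / σ * R y|) ≤ |t| * √ε := by
    simp only [abs_mul]
    rw [expectUnif_const_mul, abs_div, abs_of_pos hσ0, div_mul_eq_mul_div, mul_div_assoc]
    gcongr
    calc expectUnif n (fun y => |R y|) / σ ≤ √B / σ := by
          gcongr
          exact expectUnif_abs_le_sqrt n R
      _ = √(B / (A + B)) := (Real.sqrt_div hB0 _).symm
      _ ≤ √ε := Real.sqrt_le_sqrt hrat
  have hu2 : ∑ i, u i ^ 2 = t ^ 2 * (A / (A + B)) := by
    simp only [hu, div_pow, mul_pow, hσ2]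
    rw [← Finset.sum_div, ← Finset.mul_sum, mul_div_assoc]
  have hu4 : ∑ i, u i ^ 4 ≤ t ^ 4 * ε := by
    have hi : ∀ i, u i ^ 4 ≤ (t ^ 2 * ε) * u i ^ 2 := by
      intro i
      have : u i ^ 2 ≤ t ^ 2 * ε := by
        simp only [hu, div_pow, mul_pow, hσ2]
        rw [mul_div_assoc]
        gcongr
        rw [div_le_iff₀ hV]
        nlinarith [hM i]
      calc u i ^ 4 = u i ^ 2 * u i ^ 2 := by ring
        _ ≤ _ := by gcongr
    calc ∑ i, u i ^ 4 ≤ ∑ i, (t ^ 2 * ε) * u i ^ 2 := Finset.sum_le_sum fun i _ => hi i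
      _ = (t ^ 2 * ε) * (t ^ 2 * (A / (A + B))) := by rw [← Finset.mul_sum, hu2]
      _ ≤ (t ^ 2 * ε) * (t ^ 2 * 1) := by
        gcongr
        rw [div_le_one hV]
        linarith
      _ = t ^ 4 * ε := by ring
  have h3 := abs_prod_cos_sub_exp_le Finset.univ u
  have h4 : |Real.exp (-(∑ i, u i ^ 2) / 2) - Real.exp (-(t ^ 2 / 2))| ≤ t ^ 2 / 2 * ε := by
    have hle : A / (A + B) ≤ 1 := by
      rw [div_le_one hV]
      linarith
    have h0 : 0 ≤ A / (A + B) := by positivity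
    have h5 : 1 - A / (A + B) = B / (A + B) := by
      field_simp
      ring
    rw [hu2, neg_div]
    refine (abs_exp_neg_sub_exp_neg_le (by positivity) (by nlinarith [sq_nonneg t])).trans ?_
    calc t ^ 2 / 2 - t ^ 2 * (A / (A + B)) / 2 = t ^ 2 / 2 * (1 - A / (A + B)) := by ring
      _ ≤ _ := by rw [h5]; gcongr
  have h6 : |(∏ i, Real.cos (u i)) - Real.exp (-(t ^ 2 / 2))| ≤
      2 * t ^ 4 * ε + t ^ 2 / 2 * ε := by
    refine (abs_sub_le _ (Real.exp (-(∑ i, u i ^ 2) / 2)) _).trans ?_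
    linarith
  have h7 : ‖((∏ i, Real.cos (u i) : ℝ) : ℂ) - Complex.exp (-(t ^ 2 / 2))‖ ≤
      2 * t ^ 4 * ε + t ^ 2 / 2 * ε := by
    have : ((∏ i, Real.cos (u i) : ℝ) : ℂ) - Complex.exp (-(t ^ 2 / 2)) =
        (((∏ i, Real.cos (u i)) - Real.exp (-(t ^ 2 / 2)) : ℝ) : ℂ) := by
      push_cast
      ring_nf
    rw [this, Complex.norm_real]
    exact h6
  refine (norm_sub_le_norm_sub_add_norm_sub _ ((∏ i, Real.cos (u i) : ℝ) : ℂ) _).trans ?_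
  have h8 := h1.trans h2
  push_cast at h8 h7 ⊢
  linarith

/-- Asymptotic normality of functions of uniform strings whose linear part dominates both the
higher-order part and each single coefficient. -/
lemma tendsto_gaussian_of_decomposition (F R : ∀ n, (Fin n → Bool) → ℝ) (c : ℕ → ℝ)
    (a : ∀ n, Fin n → ℝ) (hF : ∀ n y, F n y = c n + ∑ i, a n i * bitSign (y i) + R n y)
    (hR : ∀ n, expectUnif n (R n) = 0)
    (hRi : ∀ n i, expectUnif n (fun y => bitSign (y i) * R n y) = 0)
    (ε : ℕ → ℝ) (hε : ∀ n, 0 ≤ ε n) (hε0 : Tendsto ε atTop (𝓝 0))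
    (hA : ∀ᶠ n in atTop, 0 < ∑ i, a n i ^ 2)
    (hB : ∀ᶠ n in atTop, expectUnif n (fun y => R n y ^ 2) ≤ ε n * ∑ i, a n i ^ 2)
    (hM : ∀ᶠ n in atTop, ∀ i, a n i ^ 2 ≤ ε n * ∑ i, a n i ^ 2)
    (f : BoundedContinuousFunction ℝ ℝ) :
    Tendsto (fun n => expectUnif n (fun y =>
      f ((F n y - expectUnif n (F n)) / √(varUnif n (F n))))) atTop
      (𝓝 (∫ t, f t ∂(gaussianReal 0 1))) := by
  refine tendsto_expectUnif_of_tendsto_charFun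
    (fun n y => (F n y - expectUnif n (F n)) / √(varUnif n (F n))) (fun t => ?_) f
  rw [tendsto_iff_norm_sub_tendsto_zero]
  have hlim : Tendsto (fun n => |t| * √(ε n) + 2 * t ^ 4 * ε n + t ^ 2 / 2 * ε n) atTop (𝓝 0) := by
    have h1 : Tendsto (fun n => √(ε n)) atTop (𝓝 0) := by
      have := (Real.continuous_sqrt.tendsto 0).comp hε0
      rwa [Real.sqrt_zero] at this
    simpa using ((h1.const_mul |t|).add (hε0.const_mul (2 * t ^ 4))).add
      (hε0.const_mul (t ^ 2 / 2))
  refine squeeze_zero' (Eventually.of_forall fun n => norm_nonneg _) ?_ hlim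
  filter_upwards [hA, hB, hM] with n h1 h2 h3
  exact norm_charFun_sub_gaussian_le (hF n) (hR n) (hRi n) h1 (hε n) h2 h3 t

/-! ### Walsh expansion of the embedding count -/

open Classical in
/-- The strictly increasing maps `Fin m → Fin n`. -/
noncomputable def strictMonoMaps (m n : ℕ) : Finset (Fin m → Fin n) :=
  Finset.univ.filter StrictMono

lemma mem_strictMonoMaps {m n : ℕ} {p : Fin m → Fin n} : p ∈ strictMonoMaps m n ↔ StrictMono p := by
  simp [strictMonoMaps]

/-- The coefficient of the singleton `{i}` in the Walsh expansion of `omega x`. -/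
noncomputable def linearCoeff {m : ℕ} (x : Fin m → Bool) (n : ℕ) (i : Fin n) : ℝ :=
  (∑ j, bitSign (x j) * #{p ∈ strictMonoMaps m n | p j = i}) / 2 ^ m

/-- The part of the Walsh expansion of `omega x` of degree at least two. -/
noncomputable def omegaRemainder {m : ℕ} (x : Fin m → Bool) (n : ℕ) (y : Fin n → Bool) : ℝ :=
  (∑ p ∈ strictMonoMaps m n, ∑ S : Finset (Fin m) with 2 ≤ #S,
    (∏ j ∈ S, bitSign (x j)) * walsh (S.image p) y) / 2 ^ m

lemma omega_eq_sum {m n : ℕ} (x : Fin m → Bool) (y : Fin n → Bool) :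
    (omega x y : ℝ) =
      (∑ p ∈ strictMonoMaps m n, ∏ j, (1 + bitSign (x j) * bitSign (y (p j)))) / 2 ^ m := by
  classical
  have h1 : ∀ b c : Bool, 1 + bitSign b * bitSign c = if c = b then 2 else 0 := by
    intro b c
    cases b <;> cases c <;> simp [bitSign] <;> norm_num
  have h2 : omega x y = #{p ∈ strictMonoMaps m n | ∀ j, y (p j) = x j} := by
    rw [omega, Nat.card_eq_fintype_card, Fintype.card_subtype, strictMonoMaps,
      Finset.filter_filter]
  have h3 : ∀ p : Fin m → Fin n, ∏ j, (1 + bitSign (x j) * bitSign (y (p j))) =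
      if ∀ j, y (p j) = x j then (2 : ℝ) ^ m else 0 := by
    intro p
    simp only [h1]
    rw [Finset.prod_ite_zero]
    simp
  rw [h2]
  simp only [h3]
  rw [← Finset.sum_filter]
  simp

lemma sum_finset_eq_add_sum_two_le {ι : Type*} [Fintype ι] [DecidableEq ι] (g : Finset ι → ℝ) :
    ∑ S, g S = g ∅ + ∑ j, g {j} + ∑ S with 2 ≤ #S, g S := by
  rw [← Finset.sum_filter_add_sum_filter_not Finset.univ (fun S : Finset ι => 2 ≤ #S), add_comm]
  congr 1
  have h : ({S | ¬ 2 ≤ #S} : Finset (Finset ι)) =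
      insert ∅ (Finset.univ.image fun j : ι => ({j} : Finset ι)) := by
    ext S
    simp only [Finset.mem_filter, Finset.mem_univ, true_and, Finset.mem_insert, Finset.mem_image,
      not_le]
    constructor
    · intro hS
      rcases Nat.lt_or_ge #S 1 with h0 | h1
      · left; exact Finset.card_eq_zero.1 (by omega)
      · right
        obtain ⟨j, hj⟩ := Finset.card_eq_one.1 (show #S = 1 by omega)
        exact ⟨j, hj.symm⟩
    · rintro (rfl | ⟨j, rfl⟩) <;> simp
  rw [h, Finset.sum_insert (by simp), Finset.sum_image Finset.singleton_injective.injOn]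

lemma prod_one_add_sign {m n : ℕ} (x : Fin m → Bool) (y : Fin n → Bool) {p : Fin m → Fin n}
    (hp : Function.Injective p) :
    ∏ j, (1 + bitSign (x j) * bitSign (y (p j))) =
      1 + ∑ j, bitSign (x j) * bitSign (y (p j)) +
        ∑ S : Finset (Fin m) with 2 ≤ #S, (∏ j ∈ S, bitSign (x j)) * walsh (S.image p) y := by
  rw [Finset.prod_one_add, Finset.powerset_univ, sum_finset_eq_add_sum_two_le]
  simp only [Finset.prod_empty, Finset.prod_singleton]
  congr 1
  refine Finset.sum_congr rfl fun S _ => ?_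
  rw [Finset.prod_mul_distrib, walsh, Finset.prod_image fun a _ b _ h => hp h]

lemma omega_decomposition {m n : ℕ} (x : Fin m → Bool) (y : Fin n → Bool) :
    (omega x y : ℝ) = (#(strictMonoMaps m n) : ℝ) / 2 ^ m +
      ∑ i, linearCoeff x n i * bitSign (y i) + omegaRemainder x n y := by
  have h1 : ∑ i, linearCoeff x n i * bitSign (y i) =
      (∑ p ∈ strictMonoMaps m n, ∑ j, bitSign (x j) * bitSign (y (p j))) / 2 ^ m := by
    have h2 : ∀ j, ∑ p ∈ strictMonoMaps m n, bitSign (x j) * bitSign (y (p j)) =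
        ∑ i, bitSign (x j) * #{p ∈ strictMonoMaps m n | p j = i} * bitSign (y i) := by
      intro j
      rw [← Finset.sum_fiberwise (strictMonoMaps m n) (fun p => p j)]
      refine Finset.sum_congr rfl fun i _ => ?_
      rw [Finset.sum_congr rfl (g := fun _ => bitSign (x j) * bitSign (y i))
        fun p hp => by rw [(Finset.mem_filter.1 hp).2]]
      rw [Finset.sum_const, nsmul_eq_mul]
      ring
    rw [Finset.sum_comm]
    simp only [h2]
    rw [Finset.sum_comm, Finset.sum_div]
    refine Finset.sum_congr rfl fun i _ => ?_
    rw [linearCoeff, ← Finset.sum_mul]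
    ring
  rw [omega_eq_sum, h1, omegaRemainder, ← add_div, ← add_div]
  congr 1
  rw [Finset.sum_congr rfl fun p hp =>
    prod_one_add_sign x y (mem_strictMonoMaps.1 hp).injective]
  rw [Finset.sum_add_distrib, Finset.sum_add_distrib]
  simp

lemma expectUnif_mul_omegaRemainder {m n : ℕ} (x : Fin m → Bool) (g : (Fin n → Bool) → ℝ) :
    expectUnif n (fun y => g y * omegaRemainder x n y) =
      (∑ p ∈ strictMonoMaps m n, ∑ S : Finset (Fin m) with 2 ≤ #S,
        (∏ j ∈ S, bitSign (x j)) * expectUnif n (fun y => g y * walsh (S.image p) y)) / 2 ^ m := by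
  have h : ∀ y, g y * omegaRemainder x n y = (2 ^ m)⁻¹ * ∑ p ∈ strictMonoMaps m n,
      ∑ S : Finset (Fin m) with 2 ≤ #S,
        (∏ j ∈ S, bitSign (x j)) * (g y * walsh (S.image p) y) := by
    intro y
    rw [omegaRemainder, mul_div_assoc', div_eq_inv_mul, Finset.mul_sum]
    congr 1
    refine Finset.sum_congr rfl fun p _ => ?_
    rw [Finset.mul_sum]
    exact Finset.sum_congr rfl fun S _ => by ring
  rw [funext h, expectUnif_const_mul, expectUnif_sum, div_eq_inv_mul]
  congr 1
  refine Finset.sum_congr rfl fun p _ => ?_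
  rw [expectUnif_sum]
  exact Finset.sum_congr rfl fun S _ => expectUnif_const_mul _ _ _

lemma expectUnif_walsh_mul_omegaRemainder {m n : ℕ} (x : Fin m → Bool) {T : Finset (Fin n)}
    (hT : #T ≤ 1) : expectUnif n (fun y => walsh T y * omegaRemainder x n y) = 0 := by
  rw [expectUnif_mul_omegaRemainder, Finset.sum_eq_zero, zero_div]
  intro p hp
  refine Finset.sum_eq_zero fun S hS => ?_
  have hc := Finset.card_image_of_injective S (mem_strictMonoMaps.1 hp).injective
  have hS2 := (Finset.mem_filter.1 hS).2
  rw [expectUnif_walsh_mul_walsh, if_neg, mul_zero]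
  rintro rfl
  omega

lemma expectUnif_omegaRemainder {m n : ℕ} (x : Fin m → Bool) :
    expectUnif n (omegaRemainder x n) = 0 := by
  simpa [walsh] using expectUnif_walsh_mul_omegaRemainder x (T := (∅ : Finset (Fin n))) (by simp)

lemma expectUnif_bitSign_mul_omegaRemainder {m n : ℕ} (x : Fin m → Bool) (i : Fin n) :
    expectUnif n (fun y => bitSign (y i) * omegaRemainder x n y) = 0 := by
  simpa [walsh] using expectUnif_walsh_mul_omegaRemainder x (T := {i}) (by simp)

lemma abs_prod_bitSign {m : ℕ} (x : Fin m → Bool) (S : Finset (Fin m)) :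
    |∏ j ∈ S, bitSign (x j)| = 1 := by
  rw [Finset.abs_prod]
  refine Finset.prod_eq_one fun j _ => ?_
  cases x j <;> simp [bitSign]

/-! ### Counting maps with prescribed values -/

lemma card_filter_apply_mul {m n : ℕ} (j : Fin m) (i : Fin n) :
    #{p : Fin m → Fin n | p j = i} * n = n ^ m := by
  have h : ({p | p j = i} : Finset (Fin m → Fin n)) =
      Fintype.piFinset fun k => if k = j then {i} else Finset.univ := by
    ext p
    simp only [Finset.mem_filter, Finset.mem_univ, true_and, Fintype.mem_piFinset]
    constructor
    · intro hp k
      split_ifs with hk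
      · simp [hk, hp]
      · simp
    · intro hp
      simpa using hp j
  rw [h, Fintype.card_piFinset]
  calc (∏ k, #(if k = j then {i} else (Finset.univ : Finset (Fin n)))) * n
      = ∏ k, (#(if k = j then {i} else (Finset.univ : Finset (Fin n))) * if k = j then n else 1) := by
        rw [Finset.prod_mul_distrib]
        simp
    _ = ∏ _k : Fin m, n := Finset.prod_congr rfl fun k _ => by split_ifs <;> simp
    _ = n ^ m := by simp

lemma card_filter_apply_apply_mem_mul {m n : ℕ} {j k : Fin m} (hjk : j ≠ k) (i : Fin n)
    (B : Finset (Fin n)) :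
    #{p : Fin m → Fin n | p j = i ∧ p k ∈ B} * n ^ 2 = #B * n ^ m := by
  set s : Fin m → Finset (Fin n) := fun l => if l = j then {i} else if l = k then B else Finset.univ
    with hs
  have h : ({p | p j = i ∧ p k ∈ B} : Finset (Fin m → Fin n)) = Fintype.piFinset s := by
    ext p
    simp only [Finset.mem_filter, Finset.mem_univ, true_and, Fintype.mem_piFinset, hs]
    constructor
    · rintro ⟨hp, hB⟩ l
      split_ifs with h1 h2
      · simp [h1, hp]
      · simpa [h2] using hB
      · simp
    · intro hp
      exact ⟨by simpa using hp j, by simpa [hjk.symm] using hp k⟩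
  rw [h, Fintype.card_piFinset]
  calc (∏ l, #(s l)) * n ^ 2
      = ∏ l, (#(s l) * (if l = j then n else 1) * (if l = k then n else 1)) := by
        rw [Finset.prod_mul_distrib, Finset.prod_mul_distrib]
        simp
        ring
    _ = ∏ l, ((if l = k then #B else 1) * n) := Finset.prod_congr rfl fun l _ => by
        simp only [hs]
        by_cases h1 : l = j
        · subst h1
          simp [hjk]
        · by_cases h2 : l = k
          · simp [h2, hjk.symm]
          · simp [h1, h2]
    _ = #B * n ^ m := by
        rw [Finset.prod_mul_distrib]
        simp

lemma card_filter_subset_image_mul_le {m n : ℕ} {T : Finset (Fin n)} (hT : 2 ≤ #T) :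
    #{p : Fin m → Fin n | T ⊆ Finset.univ.image p} * n ^ 2 ≤ m ^ 2 * n ^ m := by
  obtain ⟨a, ha, b, hb, hab⟩ := Finset.one_lt_card.1 (show 1 < #T by omega)
  have hsub : ({p | T ⊆ Finset.univ.image p} : Finset (Fin m → Fin n)) ⊆
      (Finset.univ.filter fun q : Fin m × Fin m => q.1 ≠ q.2).biUnion
        fun q => {p | p q.1 = a ∧ p q.2 ∈ ({b} : Finset (Fin n))} := by
    intro p hp
    have hp' := (Finset.mem_filter.1 hp).2
    obtain ⟨j, -, hj⟩ := Finset.mem_image.1 (hp' ha)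
    obtain ⟨k, -, hk⟩ := Finset.mem_image.1 (hp' hb)
    refine Finset.mem_biUnion.2 ⟨(j, k), ?_, ?_⟩
    · simp only [Finset.mem_filter, Finset.mem_univ, true_and]
      rintro rfl
      exact hab (hj.symm.trans hk)
    · simp [hj, hk]
  calc #{p : Fin m → Fin n | T ⊆ Finset.univ.image p} * n ^ 2
      ≤ (∑ q : Fin m × Fin m with q.1 ≠ q.2,
          #{p : Fin m → Fin n | p q.1 = a ∧ p q.2 ∈ ({b} : Finset (Fin n))}) * n ^ 2 := by
        gcongr
        exact (Finset.card_le_card hsub).trans Finset.card_biUnion_le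
    _ = ∑ q : Fin m × Fin m with q.1 ≠ q.2, n ^ m := by
        rw [Finset.sum_mul]
        refine Finset.sum_congr rfl fun q hq => ?_
        rw [card_filter_apply_apply_mem_mul (Finset.mem_filter.1 hq).2]
        simp
    _ ≤ m ^ 2 * n ^ m := by
        rw [Finset.sum_const, smul_eq_mul]
        gcongr
        refine (Finset.card_filter_le _ _).trans ?_
        simp [sq]

lemma card_strictMonoMaps_filter_mul_le {m n : ℕ} {j j0 : Fin m} (hj : j0 < j) (i : Fin n) :
    #{p ∈ strictMonoMaps m n | p j = i} * n ^ 2 ≤ i * n ^ m := by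
  have h := card_filter_apply_apply_mem_mul hj.ne' i (Finset.Iio i)
  rw [Fin.card_Iio] at h
  rw [← h]
  gcongr
  intro p hp
  obtain ⟨hp1, hp2⟩ := Finset.mem_filter.1 hp
  simp only [Finset.mem_filter, Finset.mem_univ, true_and, Finset.mem_Iio]
  exact ⟨hp2, hp2 ▸ mem_strictMonoMaps.1 hp1 hj⟩

lemma pow_le_card_strictMonoMaps_filter_mul {m n q : ℕ} (hm : 0 < m) (hq : m * q ≤ n) (i : Fin n)
    (hi : (i : ℕ) < q) :
    q ^ m ≤ #{p ∈ strictMonoMaps m n | p ⟨0, hm⟩ = i} * q := by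
  have hlt : ∀ j : Fin m, ∀ l ∈ Finset.Ico (j * q) (j * q + q), l < n := by
    intro j l hl
    have h1 := (Finset.mem_Ico.1 hl).2
    have h2 : ((j : ℕ) + 1) * q ≤ m * q := Nat.mul_le_mul_right _ j.2
    nlinarith
  set s : Fin m → Finset (Fin n) := fun j =>
    if j = ⟨0, hm⟩ then {i} else (Finset.Ico (j * q) (j * q + q)).attachFin (hlt j) with hs
  have hmem : ∀ p ∈ Fintype.piFinset s, p ⟨0, hm⟩ = i ∧
      ∀ j : Fin m, (j : ℕ) * q ≤ p j ∧ (p j : ℕ) < j * q + q := by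
    intro p hp
    rw [Fintype.mem_piFinset] at hp
    have h0 : p ⟨0, hm⟩ = i := by simpa [hs] using hp ⟨0, hm⟩
    refine ⟨h0, fun j => ?_⟩
    by_cases hj : j = ⟨0, hm⟩
    · subst hj
      simp [h0, hi]
    · have := hp j
      simpa [hs, hj] using this
  have hsub : Fintype.piFinset s ⊆ {p ∈ strictMonoMaps m n | p ⟨0, hm⟩ = i} := by
    intro p hp
    obtain ⟨h0, h1⟩ := hmem p hp
    refine Finset.mem_filter.2 ⟨mem_strictMonoMaps.2 fun j k hjk => ?_, h0⟩
    rw [Fin.lt_def]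
    have h2 : ((j : ℕ) + 1) * q ≤ k * q := Nat.mul_le_mul_right _ hjk
    have h3 := (h1 j).2
    have h4 := (h1 k).1
    nlinarith
  calc q ^ m = ∏ _j : Fin m, q := by simp
    _ = ∏ j, (#(s j) * if j = ⟨0, hm⟩ then q else 1) := by
        refine Finset.prod_congr rfl fun j _ => ?_
        by_cases hj : j = ⟨0, hm⟩
        · simp [hs, hj]
        · simp [hs, hj]
    _ = #(Fintype.piFinset s) * q := by
        rw [Finset.prod_mul_distrib, Fintype.card_piFinset]
        simp
    _ ≤ _ := by
        gcongr

/-! ### Size of the linear and higher-order parts -/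

lemma abs_linearCoeff_mul_le {m : ℕ} (x : Fin m → Bool) (n : ℕ) (i : Fin n) :
    |linearCoeff x n i| * n ≤ m * n ^ m := by
  have h1 : ∀ j, (#{p ∈ strictMonoMaps m n | p j = i} : ℝ) * n ≤ n ^ m := by
    intro j
    have h := card_filter_apply_mul j i
    have h' : #{p ∈ strictMonoMaps m n | p j = i} * n ≤ n ^ m := by
      rw [← h]
      gcongr
      exact Finset.subset_univ _
    exact_mod_cast h'
  have h2 : |linearCoeff x n i| ≤ ∑ j, (#{p ∈ strictMonoMaps m n | p j = i} : ℝ) := by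
    rw [linearCoeff, abs_div, abs_of_pos (show (0 : ℝ) < 2 ^ m by positivity)]
    refine (div_le_self (abs_nonneg _) (one_le_pow₀ one_le_two)).trans ?_
    refine (Finset.abs_sum_le_sum_abs _ _).trans (Finset.sum_le_sum fun j _ => ?_)
    rw [abs_mul, Nat.abs_cast]
    cases x j <;> simp [bitSign]
  calc |linearCoeff x n i| * n ≤ (∑ j, (#{p ∈ strictMonoMaps m n | p j = i} : ℝ)) * n := by gcongr
    _ ≤ ∑ _j : Fin m, (n : ℝ) ^ m := by
        rw [Finset.sum_mul]
        exact Finset.sum_le_sum fun j _ => h1 j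
    _ = m * n ^ m := by simp

lemma abs_expectUnif_walsh_mul_omegaRemainder_le {m n : ℕ} (x : Fin m → Bool) {T : Finset (Fin n)}
    (hT : 2 ≤ #T) :
    |expectUnif n (fun y => walsh T y * omegaRemainder x n y)| * n ^ 2 ≤
      2 ^ m * (m ^ 2 * n ^ m) := by
  rw [expectUnif_mul_omegaRemainder, abs_div, abs_of_pos (show (0 : ℝ) < 2 ^ m by positivity)]
  have h1 : |∑ p ∈ strictMonoMaps m n, ∑ S : Finset (Fin m) with 2 ≤ #S,
      (∏ j ∈ S, bitSign (x j)) * expectUnif n (fun y => walsh T y * walsh (S.image p) y)| ≤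
      ∑ p ∈ strictMonoMaps m n, 2 ^ m * if T ⊆ Finset.univ.image p then (1 : ℝ) else 0 := by
    refine (Finset.abs_sum_le_sum_abs _ _).trans (Finset.sum_le_sum fun p _ => ?_)
    refine (Finset.abs_sum_le_sum_abs _ _).trans ?_
    calc _ ≤ ∑ S : Finset (Fin m) with 2 ≤ #S,
          if T ⊆ Finset.univ.image p then (1 : ℝ) else 0 := by
          refine Finset.sum_le_sum fun S _ => ?_
          rw [abs_mul, abs_prod_bitSign, one_mul, expectUnif_walsh_mul_walsh]
          by_cases hTS : T = S.image p
          · rw [if_pos hTS, if_pos (hTS ▸ Finset.image_subset_image (Finset.subset_univ S))]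
            simp
          · rw [if_neg hTS, abs_zero]
            split_ifs <;> simp
      _ ≤ _ := by
          rw [Finset.sum_const, nsmul_eq_mul]
          gcongr
          have := Finset.card_filter_le (Finset.univ : Finset (Finset (Fin m))) (fun S => 2 ≤ #S)
          rw [Finset.card_univ, Fintype.card_finset, Fintype.card_fin] at this
          exact_mod_cast this
  have h2 : (∑ p ∈ strictMonoMaps m n, if T ⊆ Finset.univ.image p then (1 : ℝ) else 0) * n ^ 2 ≤
      m ^ 2 * n ^ m := by
    rw [← Finset.sum_filter, Finset.sum_const, nsmul_eq_mul, mul_one]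
    have h3 : #{p ∈ strictMonoMaps m n | T ⊆ Finset.univ.image p} * n ^ 2 ≤ m ^ 2 * n ^ m := by
      refine le_trans ?_ (card_filter_subset_image_mul_le hT)
      gcongr
      exact Finset.subset_univ _
    exact_mod_cast h3
  rw [← Finset.mul_sum] at h1
  refine le_trans ?_ (mul_le_mul_of_nonneg_left h2 (by positivity : (0 : ℝ) ≤ 2 ^ m))
  rw [← mul_assoc]
  gcongr
  exact (div_le_self (abs_nonneg _) (one_le_pow₀ one_le_two)).trans h1

lemma expectUnif_omegaRemainder_sq_mul_le {m : ℕ} (x : Fin m → Bool) (n : ℕ) :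
    expectUnif n (fun y => omegaRemainder x n y ^ 2) * n ^ 2 ≤
      4 ^ m * m ^ 2 * (n ^ m) ^ 2 := by
  have h0 : expectUnif n (fun y => omegaRemainder x n y ^ 2) ≤
      |∑ p ∈ strictMonoMaps m n, ∑ S : Finset (Fin m) with 2 ≤ #S,
        (∏ j ∈ S, bitSign (x j)) *
          expectUnif n (fun y => walsh (S.image p) y * omegaRemainder x n y)| := by
    simp only [sq]
    rw [expectUnif_mul_omegaRemainder]
    simp only [mul_comm (omegaRemainder x n _)]
    refine (le_abs_self _).trans ?_
    rw [abs_div, abs_of_pos (show (0 : ℝ) < 2 ^ m by positivity)]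
    exact div_le_self (abs_nonneg _) (one_le_pow₀ one_le_two)
  have h1 : ∀ p ∈ strictMonoMaps m n, ∀ S ∈ (Finset.univ.filter fun S : Finset (Fin m) => 2 ≤ #S),
      |(∏ j ∈ S, bitSign (x j)) *
        expectUnif n (fun y => walsh (S.image p) y * omegaRemainder x n y)| * n ^ 2 ≤
      2 ^ m * (m ^ 2 * n ^ m) := by
    intro p hp S hS
    rw [abs_mul, abs_prod_bitSign, one_mul]
    apply abs_expectUnif_walsh_mul_omegaRemainder_le
    rw [Finset.card_image_of_injective S (mem_strictMonoMaps.1 hp).injective]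
    exact (Finset.mem_filter.1 hS).2
  have hP : (#(strictMonoMaps m n) : ℝ) ≤ n ^ m := by
    have := Finset.card_le_univ (strictMonoMaps m n)
    rw [Fintype.card_fun, Fintype.card_fin, Fintype.card_fin] at this
    exact_mod_cast this
  have hS : (#(Finset.univ.filter fun S : Finset (Fin m) => 2 ≤ #S) : ℝ) ≤ 2 ^ m := by
    have := Finset.card_filter_le (Finset.univ : Finset (Finset (Fin m))) (fun S => 2 ≤ #S)
    rw [Finset.card_univ, Fintype.card_finset, Fintype.card_fin] at this
    exact_mod_cast this
  calc expectUnif n (fun y => omegaRemainder x n y ^ 2) * n ^ 2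
      ≤ (∑ p ∈ strictMonoMaps m n, ∑ S : Finset (Fin m) with 2 ≤ #S,
        |(∏ j ∈ S, bitSign (x j)) *
          expectUnif n (fun y => walsh (S.image p) y * omegaRemainder x n y)|) * n ^ 2 := by
        gcongr
        exact h0.trans ((Finset.abs_sum_le_sum_abs _ _).trans
          (Finset.sum_le_sum fun p _ => Finset.abs_sum_le_sum_abs _ _))
    _ ≤ ∑ p ∈ strictMonoMaps m n, ∑ S : Finset (Fin m) with 2 ≤ #S,
        (2 : ℝ) ^ m * (m ^ 2 * n ^ m) := by
        rw [Finset.sum_mul]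
        refine Finset.sum_le_sum fun p hp => ?_
        rw [Finset.sum_mul]
        exact Finset.sum_le_sum fun S hS => h1 p hp S hS
    _ ≤ n ^ m * (2 ^ m * (2 ^ m * (m ^ 2 * n ^ m))) := by
        rw [Finset.sum_const, Finset.sum_const, nsmul_eq_mul, nsmul_eq_mul]
        gcongr
    _ = 4 ^ m * m ^ 2 * (n ^ m) ^ 2 := by
        rw [show (4 : ℝ) = 2 * 2 by norm_num, mul_pow]
        ring

lemma le_abs_linearCoeff_mul {m n : ℕ} (hm : 0 < m) (hn : m ≤ n) (x : Fin m → Bool) (i : Fin n)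
    (hi : i * (2 * m * (2 * m) ^ m) ≤ n) :
    (n : ℝ) ^ m / (2 ^ m * (2 * (2 * m) ^ m)) ≤ |linearCoeff x n i| * n := by
  set N : Fin m → ℝ := fun j => (#{p ∈ strictMonoMaps m n | p j = i} : ℝ) with hN
  set q := n / m with hq
  have hmR : (0 : ℝ) < m := by exact_mod_cast hm
  have hnR : (0 : ℝ) < n := by exact_mod_cast hm.trans_le hn
  have hqn : m * q ≤ n := Nat.mul_div_le n m
  have hn2 : (n : ℝ) ≤ 2 * m * q := by
    have h1 : n < m * (q + 1) := Nat.lt_mul_div_succ n hm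
    have h2 : 1 ≤ q := (Nat.one_le_div_iff hm).2 hn
    have : n ≤ 2 * m * q := by nlinarith
    exact_mod_cast this
  have hiq : (i : ℕ) < q := by
    have h1 : 1 ≤ (2 * m) ^ m := Nat.one_le_pow _ _ (by omega)
    have h2 : (i : ℕ) * (2 * m * 1) ≤ n := le_trans (by gcongr) hi
    rw [hq, Nat.lt_iff_add_one_le, Nat.le_div_iff_mul_le hm]
    rcases Nat.eq_zero_or_pos (i : ℕ) with h0 | h0
    · simpa [h0] using hn
    · nlinarith
  have hmain : (n : ℝ) ^ m / (2 * m) ^ m ≤ N ⟨0, hm⟩ * n := by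
    have h1 := pow_le_card_strictMonoMaps_filter_mul hm hqn i hiq
    have h1' : (q : ℝ) ^ m ≤ N ⟨0, hm⟩ * q := by
      simp only [hN]
      exact_mod_cast h1
    rw [← div_pow]
    calc ((n : ℝ) / (2 * m)) ^ m ≤ (q : ℝ) ^ m := by
          gcongr
          rw [div_le_iff₀ (by positivity)]
          linarith
      _ ≤ N ⟨0, hm⟩ * q := h1'
      _ ≤ N ⟨0, hm⟩ * n := by
          gcongr
          exact Nat.div_le_self _ _
  have hsmall : ∀ j ∈ Finset.univ.erase (⟨0, hm⟩ : Fin m),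
      N j * n ≤ (n : ℝ) ^ m / (2 * m * (2 * m) ^ m) := by
    intro j hj
    have hj0 : (⟨0, hm⟩ : Fin m) < j := by
      have := Finset.ne_of_mem_erase hj
      rw [Fin.lt_def]
      exact Nat.pos_of_ne_zero fun h => this (Fin.ext h)
    have h1 : N j * n ^ 2 ≤ i * n ^ m := by
      simp only [hN]
      exact_mod_cast card_strictMonoMaps_filter_mul_le hj0 i
    have h2 : (i : ℝ) * (2 * m * (2 * m) ^ m) ≤ n := by exact_mod_cast hi
    rw [le_div_iff₀ (by positivity)]
    have h3 : (N j * n * (2 * m * (2 * m) ^ m)) * n ≤ n ^ m * n := by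
      calc (N j * n * (2 * m * (2 * m) ^ m)) * n = N j * n ^ 2 * (2 * m * (2 * m) ^ m) := by ring
        _ ≤ i * n ^ m * (2 * m * (2 * m) ^ m) := by gcongr
        _ = n ^ m * (i * (2 * m * (2 * m) ^ m)) := by ring
        _ ≤ n ^ m * n := by gcongr
    exact le_of_mul_le_mul_right h3 hnR
  have hsum : ∑ j ∈ Finset.univ.erase (⟨0, hm⟩ : Fin m), N j * n ≤
      (n : ℝ) ^ m / (2 * (2 * m) ^ m) := by
    calc _ ≤ ∑ j ∈ Finset.univ.erase (⟨0, hm⟩ : Fin m), (n : ℝ) ^ m / (2 * m * (2 * m) ^ m) :=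
          Finset.sum_le_sum hsmall
      _ ≤ ∑ _j : Fin m, (n : ℝ) ^ m / (2 * m * (2 * m) ^ m) :=
          Finset.sum_le_sum_of_subset_of_nonneg (Finset.erase_subset _ _)
            fun _ _ _ => by positivity
      _ = _ := by
          rw [Finset.sum_const, nsmul_eq_mul, Finset.card_univ, Fintype.card_fin]
          field_simp
  have habs : ∀ j, |bitSign (x j) * N j| = N j := by
    intro j
    simp only [hN]
    rw [abs_mul, Nat.abs_cast]
    cases x j <;> simp [bitSign]
  have hlow : N ⟨0, hm⟩ - ∑ j ∈ Finset.univ.erase (⟨0, hm⟩ : Fin m), N j ≤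
      |∑ j, bitSign (x j) * N j| := by
    rw [← Finset.add_sum_erase Finset.univ _ (Finset.mem_univ (⟨0, hm⟩ : Fin m))]
    have h1 := abs_sub_abs_le_abs_add (bitSign (x ⟨0, hm⟩) * N ⟨0, hm⟩)
      (∑ j ∈ Finset.univ.erase (⟨0, hm⟩ : Fin m), bitSign (x j) * N j)
    have h2 := Finset.abs_sum_le_sum_abs (fun j => bitSign (x j) * N j)
      (Finset.univ.erase (⟨0, hm⟩ : Fin m))
    simp only [habs] at h1 h2
    linarith
  rw [linearCoeff, abs_div, abs_of_pos (show (0 : ℝ) < 2 ^ m by positivity), mul_comm (2 ^ m : ℝ),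
    ← div_div, div_mul_eq_mul_div]
  gcongr
  rw [← Finset.sum_mul] at hsum
  have hhalf : (n : ℝ) ^ m / (2 * (2 * m) ^ m) = (n : ℝ) ^ m / (2 * m) ^ m / 2 := by
    field_simp
  rw [hhalf] at hsum ⊢
  have := mul_le_mul_of_nonneg_right hlow hnR.le
  linarith

lemma le_sum_linearCoeff_sq_mul {m n : ℕ} (hm : 0 < m) (hn : m ≤ n) (x : Fin m → Bool) :
    n * ((n : ℝ) ^ m / (2 ^ m * (2 * (2 * m) ^ m))) ^ 2 ≤
      (2 * m * (2 * m) ^ m) * ((∑ i, linearCoeff x n i ^ 2) * n ^ 2) := by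
  set D := 2 * m * (2 * m) ^ m with hD
  have hD0 : 0 < D := by positivity
  set s : Finset (Fin n) := {i | (i : ℕ) < n / D + 1} with hs
  have hcard : n ≤ D * #s := by
    rw [hs, Fin.card_filter_val_lt]
    rcases min_cases n (n / D + 1) with ⟨h, _⟩ | ⟨h, _⟩ <;> rw [h]
    · nlinarith
    · exact (Nat.lt_mul_div_succ n hD0).le
  have hterm : ∀ i ∈ s, ((n : ℝ) ^ m / (2 ^ m * (2 * (2 * m) ^ m))) ^ 2 ≤
      linearCoeff x n i ^ 2 * n ^ 2 := by
    intro i hi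
    have hi' : (i : ℕ) * D ≤ n := by
      have := (Finset.mem_filter.1 hi).2
      exact (Nat.le_div_iff_mul_le hD0).1 (by omega)
    have h := le_abs_linearCoeff_mul hm hn x i hi'
    calc _ ≤ (|linearCoeff x n i| * n) ^ 2 := by gcongr
      _ = _ := by rw [mul_pow, sq_abs]
  have hcast : (2 * m * (2 * m) ^ m : ℝ) = (D : ℝ) := by
    rw [hD]
    push_cast
    ring
  have hcardR : (n : ℝ) ≤ D * #s := by exact_mod_cast hcard
  rw [hcast]
  calc (n : ℝ) * ((n : ℝ) ^ m / (2 ^ m * (2 * (2 * m) ^ m))) ^ 2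
      ≤ (D * #s) * ((n : ℝ) ^ m / (2 ^ m * (2 * (2 * m) ^ m))) ^ 2 := by gcongr
    _ = (D : ℝ) * ∑ i ∈ s, ((n : ℝ) ^ m / (2 ^ m * (2 * (2 * m) ^ m))) ^ 2 := by
        rw [Finset.sum_const, nsmul_eq_mul, mul_assoc]
    _ ≤ (D : ℝ) * ∑ i, linearCoeff x n i ^ 2 * n ^ 2 := by
        gcongr
        exact (Finset.sum_le_sum hterm).trans (Finset.sum_le_sum_of_subset_of_nonneg
          (Finset.subset_univ _) fun _ _ _ => by positivity)
    _ = _ := by rw [Finset.sum_mul]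

end CentralLimit

/-- The normalized occurrence count `X_n := (Ω_n(x) − E[Ω_n(x)])/√(Var[Ω_n(x)])` converges
in distribution to a standard normal: for every bounded continuous `f : ℝ → ℝ`,
`E[f(X_n)]` converges to `∫ f dN(0,1)`. -/
theorem normalized_omega_tendsto_gaussian (m : ℕ) (hm : 0 < m) (x : Fin m → Bool)
    (f : BoundedContinuousFunction ℝ ℝ) :
    Filter.Tendsto
      (fun n : ℕ => expectUnif n (fun y =>
        f (((omega x y : ℝ) - expectUnif n (fun y' => (omega x y' : ℝ))) /
            Real.sqrt (varUnif n (fun y' => (omega x y' : ℝ))))))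
      Filter.atTop
      (nhds (∫ t, f t ∂(ProbabilityTheory.gaussianReal 0 1))) := by
  set δ : ℝ := 1 / (2 ^ m * (2 * (2 * m) ^ m)) with hδ
  set D : ℝ := 2 * m * (2 * m) ^ m with hD
  set C : ℝ := 4 ^ m * m ^ 2 with hC
  have hmR : (0 : ℝ) < m := by exact_mod_cast hm
  have hδ0 : 0 < δ := by positivity
  have hC0 : 0 < C := by positivity
  have hA : ∀ n ≥ m, (n : ℝ) * (δ * n ^ m) ^ 2 ≤ D * ((∑ i, linearCoeff x n i ^ 2) * n ^ 2) := by
    intro n hn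
    have h := le_sum_linearCoeff_sq_mul hm hn x
    rwa [div_eq_inv_mul, ← one_div] at h
  have hbound : ∀ n ≥ m, ∀ b : ℝ, b * n ^ 2 ≤ C * (n ^ m) ^ 2 →
      b ≤ C * D / δ ^ 2 / n * ∑ i, linearCoeff x n i ^ 2 := by
    intro n hn b hb
    have hnR : (0 : ℝ) < n := by exact_mod_cast hm.trans_le hn
    rw [div_div, div_mul_eq_mul_div, le_div_iff₀ (by positivity)]
    refine le_of_mul_le_mul_right ?_ (show (0 : ℝ) < n ^ 2 by positivity)
    calc b * (δ ^ 2 * n) * n ^ 2 = (b * n ^ 2) * (δ ^ 2 * n) := by ring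
      _ ≤ (C * (n ^ m) ^ 2) * (δ ^ 2 * n) := by gcongr
      _ = C * (n * (δ * n ^ m) ^ 2) := by ring
      _ ≤ C * (D * ((∑ i, linearCoeff x n i ^ 2) * n ^ 2)) := by
          exact mul_le_mul_of_nonneg_left (hA n hn) hC0.le
      _ = _ := by ring
  refine tendsto_gaussian_of_decomposition (fun n y => (omega x y : ℝ))
    (fun n => omegaRemainder x n) (fun n => (strictMonoMaps m n).card / 2 ^ m)
    (fun n => linearCoeff x n) (fun n y => omega_decomposition x y)
    (fun n => expectUnif_omegaRemainder x) (fun n => expectUnif_bitSign_mul_omegaRemainder x)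
    (fun n => C * D / δ ^ 2 / n) (fun n => by positivity)
    (tendsto_const_div_atTop_nhds_zero_nat _) ?_ ?_ ?_ f
  · filter_upwards [eventually_ge_atTop m] with n hn
    have hnR : (0 : ℝ) < n := by exact_mod_cast hm.trans_le hn
    by_contra! h
    have h1 : 0 < (n : ℝ) * (δ * n ^ m) ^ 2 := by positivity
    have h2 : D * ((∑ i, linearCoeff x n i ^ 2) * n ^ 2) ≤ 0 :=
      mul_nonpos_of_nonneg_of_nonpos (by positivity)
        (mul_nonpos_of_nonpos_of_nonneg h (by positivity))
    linarith [hA n hn]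
  · filter_upwards [eventually_ge_atTop m] with n hn
    exact hbound n hn _ (expectUnif_omegaRemainder_sq_mul_le x n)
  · filter_upwards [eventually_ge_atTop m] with n hn i
    refine hbound n hn _ ?_
    have h4 : (1 : ℝ) ≤ 4 ^ m := one_le_pow₀ (by norm_num)
    calc linearCoeff x n i ^ 2 * (n : ℝ) ^ 2 = (|linearCoeff x n i| * n) ^ 2 := by
          rw [mul_pow, sq_abs]
      _ ≤ ((m : ℝ) * (n : ℝ) ^ m) ^ 2 := by
          exact pow_le_pow_left₀ (by positivity) (abs_linearCoeff_mul_le x n i) 2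
      _ = 1 * ((m : ℝ) ^ 2 * ((n : ℝ) ^ m) ^ 2) := by ring
      _ ≤ 4 ^ m * ((m : ℝ) ^ 2 * ((n : ℝ) ^ m) ^ 2) := by gcongr
      _ = C * (n ^ m) ^ 2 := by ring
end

section
/- For every positive integer m there exists N such that for all n > N and every nonconstant binary string x ∈ {0,1}^m (i.e., x ≠ 0^m and x ≠ 1^m), Σ_{y ∈ {0,1}^n} ω_x(y) · log₂ ω_x(y) < Σ_{y ∈ {0,1}^n} ω_{0^m}(y) · log₂ ω_{0^m}(y), where summands with ω = 0 are taken to be 0; that is, the constant strings uniquely maximize E[Ω_n log₂ Ω_n] for sufficiently large n. -/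
section Auxiliary

open Finset

theorem Finset.sum_cons_bool {n : ℕ} (F : (Fin (n + 1) → Bool) → ℝ) :
    ∑ y, F y = ∑ y : Fin n → Bool,
      (F (Fin.cons false y : Fin (n + 1) → Bool) + F (Fin.cons true y : Fin (n + 1) → Bool)) := by
  rw [← (Fin.consEquiv (fun _ : Fin (n + 1) => Bool)).sum_comp, Fintype.sum_prod_type,
    Fintype.sum_bool, ← Finset.sum_add_distrib]
  exact Finset.sum_congr rfl fun y _ => add_comm _ _

/-- Second and fourth moment bounds for a centred function on the cube with bounded differences. -/
theorem moment_bounds_of_bounded_differences (c : ℝ) :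
    ∀ (n : ℕ) (F : (Fin n → Bool) → ℝ),
      (∀ y i b, |F (Function.update y i b) - F y| ≤ c) → ∑ y, F y = 0 →
      ∑ y, F y ^ 2 ≤ n * c ^ 2 * 2 ^ n ∧ ∑ y, F y ^ 4 ≤ 3 * n ^ 2 * c ^ 4 * 2 ^ n := by
  intro n
  induction n with
  | zero =>
    intro F _ h0
    rw [Fintype.sum_unique] at h0
    simp [h0]
  | succ n ih =>
    intro F hF h0
    set g : (Fin n → Bool) → ℝ := fun y =>
      (F (Fin.cons false y : Fin (n + 1) → Bool) + F (Fin.cons true y : Fin (n + 1) → Bool)) / 2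
      with hg
    set h : (Fin n → Bool) → ℝ := fun y =>
      (F (Fin.cons true y : Fin (n + 1) → Bool) - F (Fin.cons false y : Fin (n + 1) → Bool)) / 2
      with hh
    have hh2 : ∀ y, h y ^ 2 ≤ c ^ 2 := by
      intro y
      have h1 := hF (Fin.cons false y : Fin (n + 1) → Bool) 0 true
      rw [Fin.update_cons_zero] at h1
      have hc : |h y| ≤ c := by
        simp only [hh, abs_div, abs_two]
        linarith [abs_nonneg (F (Fin.cons true y : Fin (n + 1) → Bool) -
          F (Fin.cons false y : Fin (n + 1) → Bool))]
      rw [← sq_abs]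
      gcongr
    have hgd : ∀ y i b, |g (Function.update y i b) - g y| ≤ c := by
      intro y i b
      have h1 := hF (Fin.cons false y : Fin (n + 1) → Bool) i.succ b
      have h2 := hF (Fin.cons true y : Fin (n + 1) → Bool) i.succ b
      rw [← Fin.cons_update] at h1 h2
      simp only [hg]
      rw [abs_le] at *
      constructor <;> linarith [h1.1, h1.2, h2.1, h2.2]
    have hg0 : ∑ y, g y = 0 := by
      rw [Finset.sum_cons_bool] at h0
      simp only [hg]
      rw [← Finset.sum_div, h0, zero_div]
    obtain ⟨i2, i4⟩ := ih g hgd hg0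
    have e2 : ∑ y, F y ^ 2 = ∑ y, 2 * (g y ^ 2 + h y ^ 2) := by
      rw [Finset.sum_cons_bool]
      exact Finset.sum_congr rfl fun y _ => by simp only [hg, hh]; ring
    have e4 : ∑ y, F y ^ 4 = ∑ y, 2 * (g y ^ 4 + 6 * (g y ^ 2 * h y ^ 2) + (h y ^ 2) ^ 2) := by
      rw [Finset.sum_cons_bool]
      exact Finset.sum_congr rfl fun y _ => by simp only [hg, hh]; ring
    have b2 : ∑ y, F y ^ 2 ≤ 2 * (∑ y, g y ^ 2 + c ^ 2 * 2 ^ n) := by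
      calc ∑ y, F y ^ 2 ≤ ∑ y, 2 * (g y ^ 2 + c ^ 2) := by
            rw [e2]
            exact Finset.sum_le_sum fun y _ => by linarith [hh2 y]
        _ = _ := by
            rw [← Finset.mul_sum, Finset.sum_add_distrib]
            simp [mul_comm]
    have b4 : ∑ y, F y ^ 4 ≤ 2 * (∑ y, g y ^ 4 + 6 * (c ^ 2 * ∑ y, g y ^ 2) + c ^ 4 * 2 ^ n) := by
      calc ∑ y, F y ^ 4 ≤ ∑ y, 2 * (g y ^ 4 + 6 * (c ^ 2 * g y ^ 2) + c ^ 4) := by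
            rw [e4]
            refine Finset.sum_le_sum fun y _ => ?_
            have h1 := mul_le_mul_of_nonneg_left (hh2 y) (sq_nonneg (g y))
            have h2 := pow_le_pow_left₀ (sq_nonneg (h y)) (hh2 y) 2
            linarith
        _ = _ := by
            rw [← Finset.mul_sum, Finset.sum_add_distrib, Finset.sum_add_distrib,
              ← Finset.mul_sum, ← Finset.mul_sum]
            simp [mul_comm]
    constructor
    · push_cast
      rw [pow_succ 2 n]
      linarith
    · push_cast
      have h5 : c ^ 2 * ∑ y, g y ^ 2 ≤ c ^ 2 * (n * c ^ 2 * 2 ^ n) := by gcongr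
      have h6 : (0 : ℝ) ≤ c ^ 4 * 2 ^ n := by positivity
      calc ∑ y, F y ^ 4
          ≤ 2 * (3 * n ^ 2 * c ^ 4 * 2 ^ n + 6 * (c ^ 2 * (n * c ^ 2 * 2 ^ n)) + c ^ 4 * 2 ^ n) := by
            linarith
        _ = 2 * (3 * n ^ 2 + 6 * n + 1) * (c ^ 4 * 2 ^ n) := by ring
        _ ≤ 2 * (3 * n ^ 2 + 6 * n + 3) * (c ^ 4 * 2 ^ n) := by gcongr; norm_num
        _ = _ := by ring

theorem sum_abs_pow_three_le {n : ℕ} {c : ℝ} (hc : 0 < c) (hn : 0 < n) (F : (Fin n → Bool) → ℝ)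
    (hF : ∀ y i b, |F (Function.update y i b) - F y| ≤ c) (h0 : ∑ y, F y = 0) :
    ∑ y, |F y| ^ 3 ≤ 2 * c ^ 3 * n * √n * 2 ^ n := by
  obtain ⟨h2, h4⟩ := moment_bounds_of_bounded_differences c n F hF h0
  have hs : 0 < √(n : ℝ) := by positivity
  have hs2 : √(n : ℝ) ^ 2 = n := Real.sq_sqrt (by positivity)
  set s := √(n : ℝ)
  have key : ∀ y, c * s * (2 * |F y| ^ 3) ≤ (c * s) ^ 2 * F y ^ 2 + F y ^ 4 := by
    intro y
    have h := mul_nonneg (sq_nonneg (F y)) (sq_nonneg (c * s - |F y|))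
    rw [← sq_abs (F y)] at *
    have e : F y ^ 4 = |F y| ^ 4 := by rw [← abs_pow, abs_of_nonneg (by positivity)]
    rw [e]
    nlinarith
  have hsum := Finset.sum_le_sum fun y (_ : y ∈ univ) => key y
  rw [← Finset.mul_sum, ← Finset.mul_sum, Finset.sum_add_distrib, ← Finset.mul_sum] at hsum
  have hcs : 0 < c * s := by positivity
  refine le_of_mul_le_mul_left ?_ (mul_pos hcs two_pos)
  calc c * s * 2 * ∑ y, |F y| ^ 3 = c * s * (2 * ∑ y, |F y| ^ 3) := by ring
    _ ≤ (c * s) ^ 2 * (n * c ^ 2 * 2 ^ n) + 3 * n ^ 2 * c ^ 4 * 2 ^ n := by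
        have := mul_le_mul_of_nonneg_left h2 (sq_nonneg (c * s))
        linarith
    _ = c * s * 2 * (2 * c ^ 3 * n * s * 2 ^ n) := by
        rw [← hs2]; ring

theorem abs_mul_log_sub_le {r : ℝ} (hr : 0 ≤ r) :
    |r * Real.log r - (r - 1) - (r - 1) ^ 2 / 2| ≤ 4 * |r - 1| ^ 3 := by
  rcases le_or_gt |r - 1| (1 / 2) with h | h
  · have h1 : |1 - r| ≤ 1 / 2 := by rwa [abs_sub_comm]
    have hl := Real.abs_log_sub_add_sum_range_le (show |1 - r| < 1 by linarith) 2
    simp only [Finset.sum_range_succ, Finset.sum_range_zero, sub_sub_cancel] at hl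
    rw [abs_sub_comm 1 r] at hl
    have hd : |r - 1| ^ (2 + 1) / (1 - |r - 1|) ≤ 2 * |r - 1| ^ 3 := by
      rw [div_le_iff₀ (by linarith)]
      norm_num only
      have h3 := mul_le_mul_of_nonneg_left h (pow_nonneg (abs_nonneg (r - 1)) 3)
      linarith
    have hl2 := hl.trans hd
    have hr2 : r ≤ 3 / 2 := by linarith [(abs_le.1 h).2]
    have e : r * Real.log r - (r - 1) - (r - 1) ^ 2 / 2 =
        r * ((0 + (1 - r) ^ (0 + 1) / ((0 : ℕ) + 1) + (1 - r) ^ (1 + 1) / ((1 : ℕ) + 1)) +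
          Real.log r) - (r - 1) ^ 3 / 2 := by
      push_cast; ring
    rw [e]
    refine (abs_sub _ _).trans ?_
    rw [abs_mul, abs_div, abs_pow, abs_two, abs_of_nonneg hr]
    have h3 := mul_le_mul hr2 hl2 (abs_nonneg _) (by norm_num)
    nlinarith [pow_nonneg (abs_nonneg (r - 1)) 3]
  · have hu : r * Real.log r ≤ r * (r - 1) := by
      rcases hr.eq_or_lt with rfl | h0
      · simp
      · exact mul_le_mul_of_nonneg_left (Real.log_le_sub_one_of_pos h0) hr
    have hlow : r - 1 ≤ r * Real.log r := by
      rcases hr.eq_or_lt with rfl | h0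
      · simp
      · have := Real.one_sub_inv_le_log_of_pos h0
        calc r - 1 = r * (1 - r⁻¹) := by field_simp
          _ ≤ _ := mul_le_mul_of_nonneg_left this hr
    have h3 : (r - 1) ^ 2 / 2 ≤ 4 * |r - 1| ^ 3 := by
      rw [← sq_abs]
      nlinarith [sq_nonneg |r - 1|]
    rw [abs_le]
    constructor <;> nlinarith

theorem abs_sum_mul_log_sub_le {Y : Type*} [Fintype Y] (W : Y → ℝ) (hW : ∀ y, 0 ≤ W y) {μ : ℝ}
    (hμ : 0 < μ) (hsum : ∑ y, (W y - μ) = 0) :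
    |∑ y, W y * Real.log (W y) - (∑ y, W y) * Real.log μ - (∑ y, (W y - μ) ^ 2) / (2 * μ)| ≤
      4 * (∑ y, |W y - μ| ^ 3) / μ ^ 2 := by
  have key : ∀ y, |W y * Real.log (W y) - W y * Real.log μ - (W y - μ) - (W y - μ) ^ 2 / (2 * μ)| ≤
      4 * |W y - μ| ^ 3 / μ ^ 2 := by
    intro y
    have h := abs_mul_log_sub_le (div_nonneg (hW y) hμ.le)
    have e1 : W y / μ - 1 = (W y - μ) / μ := by field_simp
    have e2 : W y * Real.log (W y) - W y * Real.log μ = W y * Real.log (W y / μ) := by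
      rcases (hW y).eq_or_lt with h0 | h0
      · simp [← h0]
      · rw [Real.log_div h0.ne' hμ.ne']; ring
    rw [e1] at h
    rw [e2]
    have e3 : W y * Real.log (W y / μ) - (W y - μ) - (W y - μ) ^ 2 / (2 * μ) =
        μ * (W y / μ * Real.log (W y / μ) - (W y - μ) / μ - ((W y - μ) / μ) ^ 2 / 2) := by
      field_simp
    rw [e3, abs_mul, abs_of_pos hμ]
    refine (mul_le_mul_of_nonneg_left h hμ.le).trans (le_of_eq ?_)
    rw [abs_div, abs_of_pos hμ]
    field_simp
  have e : ∑ y, W y * Real.log (W y) - (∑ y, W y) * Real.log μ - (∑ y, (W y - μ) ^ 2) / (2 * μ) =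
      ∑ y, (W y * Real.log (W y) - W y * Real.log μ - (W y - μ) - (W y - μ) ^ 2 / (2 * μ)) := by
    rw [Finset.sum_sub_distrib, Finset.sum_sub_distrib, Finset.sum_sub_distrib, hsum,
      Finset.sum_mul, Finset.sum_div, sub_zero]
  rw [e, Finset.mul_sum, Finset.sum_div]
  exact (Finset.abs_sum_le_sum_abs _ _).trans (Finset.sum_le_sum fun y _ => key y)

/-- A larger second moment dominates the third-order error terms in the comparison of
`∑ W log W` for two functions with the same mean. -/
theorem sum_mul_log_lt_of_sq_gap {Y : Type*} [Fintype Y] (V W : Y → ℝ) (hV : ∀ y, 0 ≤ V y)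
    (hW : ∀ y, 0 ≤ W y) {μ T : ℝ} (hμ : 0 < μ) (hV0 : ∑ y, (V y - μ) = 0)
    (hW0 : ∑ y, (W y - μ) = 0) (hVT : ∑ y, |V y - μ| ^ 3 ≤ T) (hWT : ∑ y, |W y - μ| ^ 3 ≤ T)
    (hgap : 16 * T < μ * (∑ y, W y ^ 2 - ∑ y, V y ^ 2)) :
    ∑ y, V y * Real.log (V y) < ∑ y, W y * Real.log (W y) := by
  have h1 := (abs_le.1 (abs_sum_mul_log_sub_le V hV hμ hV0)).2
  have h2 := (abs_le.1 (abs_sum_mul_log_sub_le W hW hμ hW0)).1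
  have hs : ∑ y, V y = ∑ y, W y := by
    rw [Finset.sum_sub_distrib] at hV0 hW0
    linarith
  have hsq : ∑ y, (W y - μ) ^ 2 - ∑ y, (V y - μ) ^ 2 = ∑ y, W y ^ 2 - ∑ y, V y ^ 2 := by
    have e : ∀ y, (W y - μ) ^ 2 - (V y - μ) ^ 2 =
        (W y ^ 2 - V y ^ 2) - 2 * μ * (W y - V y) := fun y => by ring
    rw [← Finset.sum_sub_distrib, Finset.sum_congr rfl fun y _ => e y, Finset.sum_sub_distrib,
      ← Finset.mul_sum, Finset.sum_sub_distrib, Finset.sum_sub_distrib, hs]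
    ring
  have hT1 : 4 * (∑ y, |V y - μ| ^ 3) / μ ^ 2 ≤ 4 * T / μ ^ 2 := by gcongr
  have hT2 : 4 * (∑ y, |W y - μ| ^ 3) / μ ^ 2 ≤ 4 * T / μ ^ 2 := by gcongr
  have hg : 2 * (4 * T / μ ^ 2) <
      (∑ y, (W y - μ) ^ 2) / (2 * μ) - (∑ y, (V y - μ) ^ 2) / (2 * μ) := by
    rw [← sub_div, hsq, ← mul_div_assoc, div_lt_div_iff₀ (by positivity) (by positivity)]
    nlinarith
  rw [hs] at h1
  linarith

theorem card_fiber_eq_of_nonempty {ι : Type*} [Fintype ι] {n : ℕ} (p : ι → Fin n) (x : ι → Bool)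
    (y₀ : Fin n → Bool) (h₀ : ∀ i, y₀ (p i) = x i) :
    #{y : Fin n → Bool | ∀ i, y (p i) = x i} = #{y : Fin n → Bool | ∀ i, y (p i) = false} := by
  refine Finset.card_bij' (fun y _ k => xor (y k) (y₀ k)) (fun y _ k => xor (y k) (y₀ k))
    ?_ ?_ ?_ ?_
  · intro y hy
    simp only [mem_filter, mem_univ, true_and] at hy ⊢
    intro i; simp [hy i, h₀ i]
  · intro y hy
    simp only [mem_filter, mem_univ, true_and] at hy ⊢
    intro i; simp [hy i, h₀ i]
  · intro y _; funext k; simp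
  · intro y _; funext k; simp

theorem card_fiber_le {ι : Type*} [Fintype ι] {n : ℕ} (p : ι → Fin n) (x : ι → Bool) :
    #{y : Fin n → Bool | ∀ i, y (p i) = x i} ≤ #{y : Fin n → Bool | ∀ i, y (p i) = false} := by
  by_cases h : ∃ y₀ : Fin n → Bool, ∀ i, y₀ (p i) = x i
  · obtain ⟨y₀, h₀⟩ := h
    exact (card_fiber_eq_of_nonempty p x y₀ h₀).le
  · rw [Finset.filter_false_of_mem fun y _ hy => h ⟨y, hy⟩]
    simp

theorem card_fiber_eq_of_injective {ι : Type*} [Fintype ι] {n : ℕ} {p : ι → Fin n}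
    (hp : Function.Injective p) (x : ι → Bool) :
    #{y : Fin n → Bool | ∀ i, y (p i) = x i} = #{y : Fin n → Bool | ∀ i, y (p i) = false} :=
  card_fiber_eq_of_nonempty p x (Function.extend p x fun _ => false) fun i => hp.extend_apply _ _ i

theorem two_pow_le_card_fiber {ι : Type*} [Fintype ι] [DecidableEq ι] {n : ℕ} (p : ι → Fin n) :
    2 ^ n ≤ 2 ^ Fintype.card ι * #{y : Fin n → Bool | ∀ i, y (p i) = false} := by
  have h := Finset.card_eq_sum_card_fiberwise (s := (univ : Finset (Fin n → Bool)))
    (t := (univ : Finset (ι → Bool))) (f := fun y i => y (p i)) (fun _ _ => by simp)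
  have hb : ∀ x ∈ (univ : Finset (ι → Bool)),
      #{y : Fin n → Bool | (fun i => y (p i)) = x} ≤
        #{y : Fin n → Bool | ∀ i, y (p i) = false} := fun x _ => by
    simpa only [funext_iff] using card_fiber_le p x
  have := Finset.sum_le_sum hb
  rw [← h] at this
  simpa using this

/-- Strictly increasing index maps. -/
abbrev StrictMonoMap (m n : ℕ) := {π : Fin m → Fin n // StrictMono π}

theorem omega_eq_sum_s18 {m n : ℕ} (x : Fin m → Bool) (y : Fin n → Bool) :
    omega x y = ∑ π : StrictMonoMap m n, if ∀ j, y (π.1 j) = x j then 1 else 0 := by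
  rw [omega, Finset.sum_boole, Nat.cast_id, ← Fintype.card_subtype, ← Nat.card_eq_fintype_card]
  exact Nat.card_congr (Equiv.subtypeSubtypeEquivSubtypeInter _ _).symm

theorem sum_omega {m n : ℕ} (x : Fin m → Bool) :
    ∑ y : Fin n → Bool, omega x y =
      ∑ π : StrictMonoMap m n, #{y : Fin n → Bool | ∀ j, y (π.1 j) = x j} := by
  simp_rw [omega_eq_sum_s18]
  rw [Finset.sum_comm]
  simp

theorem sum_omega_sq {m n : ℕ} (x : Fin m → Bool) :
    ∑ y : Fin n → Bool, omega x y ^ 2 = ∑ q : StrictMonoMap m n × StrictMonoMap m n,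
      #{y : Fin n → Bool | ∀ j, y (Sum.elim q.1.1 q.2.1 j) = Sum.elim x x j} := by
  have e : ∀ y : Fin n → Bool, omega x y ^ 2 = ∑ q : StrictMonoMap m n × StrictMonoMap m n,
      if ∀ j, y (Sum.elim q.1.1 q.2.1 j) = Sum.elim x x j then 1 else 0 := by
    intro y
    rw [omega_eq_sum_s18, sq, Finset.sum_mul_sum, ← Fintype.sum_prod_type']
    refine Finset.sum_congr rfl fun q _ => ?_
    simp only [Sum.forall, Sum.elim_inl, Sum.elim_inr, ite_and, ite_mul, one_mul, zero_mul]
  rw [Finset.sum_congr rfl fun y _ => e y, Finset.sum_comm]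
  simp

theorem sum_omega_eq {m n : ℕ} (x : Fin m → Bool) :
    ∑ y : Fin n → Bool, omega x y = ∑ y : Fin n → Bool, omega (fun _ : Fin m => false) y := by
  rw [sum_omega, sum_omega]
  exact Finset.sum_congr rfl fun π _ => by
    convert card_fiber_eq_of_injective π.2.injective x

theorem card_strictMonoMap_mul_le (m n : ℕ) :
    Fintype.card (StrictMonoMap m n) * 2 ^ n ≤
      2 ^ m * ∑ y : Fin n → Bool, omega (fun _ : Fin m => false) y := by
  rw [sum_omega, Finset.mul_sum, ← smul_eq_mul, ← Finset.card_univ, ← Finset.sum_const]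
  refine Finset.sum_le_sum fun π _ => ?_
  have h := two_pow_le_card_fiber π.1
  rw [Fintype.card_fin] at h
  refine h.trans (le_of_eq ?_)
  congr!

theorem omega_le_add_card {m n : ℕ} (x : Fin m → Bool) {y z : Fin n → Bool} {i : Fin n}
    (h : ∀ k, k ≠ i → y k = z k) :
    omega x y ≤ omega x z + #{π : StrictMonoMap m n | ∃ j, π.1 j = i} := by
  rw [omega_eq_sum_s18, omega_eq_sum_s18, Finset.card_filter, ← Finset.sum_add_distrib]
  refine Finset.sum_le_sum fun π _ => ?_
  by_cases hi : ∃ j, π.1 j = i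
  · rw [if_pos hi]
    split_ifs <;> simp
  · push Not at hi
    simp [h _ (hi _)]

theorem card_strictMonoMap_through_le (k n : ℕ) (i : Fin n) :
    #{π : StrictMonoMap (k + 1) n | ∃ j, π.1 j = i} ≤ (k + 1) * n ^ k := by
  have h1 : #{π : StrictMonoMap (k + 1) n | ∃ j, π.1 j = i} ≤
      #((univ : Finset (Fin (k + 1) × (Fin k → Fin n))).image
        fun q => (q.1.insertNth i q.2 : Fin (k + 1) → Fin n)) := by
    refine Finset.card_le_card_of_injOn (fun π => π.1) ?_ (Subtype.val_injective.injOn)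
    intro π hπ
    obtain ⟨j, hj⟩ := (Finset.mem_filter.1 hπ).2
    simp only [coe_image, Set.mem_image, coe_univ, Set.mem_univ, true_and]
    exact ⟨(j, j.removeNth π.1), by simp [← hj]⟩
  refine h1.trans (Finset.card_image_le.trans ?_)
  simp

theorem abs_omega_update_sub_le {k n : ℕ} (x : Fin (k + 1) → Bool) (y : Fin n → Bool) (i : Fin n)
    (b : Bool) :
    |(omega x (Function.update y i b) : ℝ) - omega x y| ≤ (k + 1) * n ^ k := by
  have hc := card_strictMonoMap_through_le k n i
  have h1 := (omega_le_add_card x (y := Function.update y i b) (z := y) (i := i)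
    fun l hl => Function.update_of_ne hl _ _).trans (Nat.add_le_add_left hc _)
  have h2 := (omega_le_add_card x (y := y) (z := Function.update y i b) (i := i)
    fun l hl => (Function.update_of_ne hl _ _).symm).trans (Nat.add_le_add_left hc _)
  rify at h1 h2
  rw [abs_le]
  constructor <;> linarith

/-- The index map whose `i`-th value lies in the block of length `L` number `i + a`, at
offset `u i`. -/
def blockMap {m n L : ℕ} (h : 2 * m * L ≤ n) (a : Fin m) (u : Fin m → Fin L) :
    StrictMonoMap m n :=
  ⟨fun i => ⟨(i + a) * L + u i, by
    have h1 : (i + a + 1) * L ≤ 2 * m * L := Nat.mul_le_mul_right _ (by omega)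
    have := (u i).2
    rw [add_mul] at h1
    omega⟩, by
    intro i j hij
    rw [Fin.lt_def]
    have h1 : (i + a + 1) * L ≤ (j + a) * L := Nat.mul_le_mul_right _ (by omega)
    have := (u i).2
    rw [add_mul] at h1
    dsimp only
    omega⟩

theorem blockMap_injective {m n L : ℕ} (h : 2 * m * L ≤ n) (a : Fin m) :
    Function.Injective (blockMap h a) := by
  intro u v huv
  funext i
  have := congrArg (fun π => (π.1 i).1) huv
  simp only [blockMap] at this
  exact Fin.ext (by omega)

theorem pow_le_card_strictMonoMap {m n L : ℕ} (hm : 0 < m) (h : 2 * m * L ≤ n) :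
    L ^ m ≤ Fintype.card (StrictMonoMap m n) := by
  simpa using Fintype.card_le_of_injective _ (blockMap_injective h ⟨0, hm⟩)

theorem pow_le_card_meeting {k n L : ℕ} (h : 2 * (k + 1) * L ≤ n) (a b : Fin (k + 1)) :
    L ^ (2 * k + 1) ≤
      #{q : StrictMonoMap (k + 1) n × StrictMonoMap (k + 1) n | q.1.1 a = q.2.1 b} := by
  have hinj : Function.Injective fun r : (Fin (k + 1) → Fin L) × (Fin k → Fin L) =>
      (blockMap h b r.1, blockMap h a (b.insertNth (r.1 a) r.2)) := by
    rintro ⟨u, v⟩ ⟨u', v'⟩ huv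
    simp only [Prod.mk.injEq] at huv
    obtain rfl := blockMap_injective h b huv.1
    have := blockMap_injective h a huv.2
    rw [Fin.insertNth_injective2.eq_iff] at this
    rw [this.2]
  have := Finset.card_le_card_of_injOn (s := univ)
    (t := {q : StrictMonoMap (k + 1) n × StrictMonoMap (k + 1) n | q.1.1 a = q.2.1 b}) _
    (fun r _ => by
      simp [blockMap, add_comm]) hinj.injOn
  refine le_trans (le_of_eq ?_) this
  simp
  ring

theorem sum_omega_sq_gap {k n L : ℕ} (h : 2 * (k + 1) * L ≤ n) (x : Fin (k + 1) → Bool)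
    {a b : Fin (k + 1)} (hab : x a ≠ x b) :
    2 ^ (2 * (k + 1)) * ∑ y : Fin n → Bool, omega x y ^ 2 + L ^ (2 * k + 1) * 2 ^ n ≤
      2 ^ (2 * (k + 1)) * ∑ y : Fin n → Bool, omega (fun _ : Fin (k + 1) => false) y ^ 2 := by
  calc _ ≤ 2 ^ (2 * (k + 1)) * ∑ y : Fin n → Bool, omega x y ^ 2 +
        #{q : StrictMonoMap (k + 1) n × StrictMonoMap (k + 1) n | q.1.1 a = q.2.1 b} * 2 ^ n := by
        gcongr; exact pow_le_card_meeting h a b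
    _ ≤ _ := by
        rw [sum_omega_sq, sum_omega_sq, Finset.card_filter, Finset.sum_mul, Finset.mul_sum,
          Finset.mul_sum, ← Finset.sum_add_distrib]
        refine Finset.sum_le_sum fun q _ => ?_
        have e : (Sum.elim (fun _ => false) (fun _ => false) : Fin (k + 1) ⊕ Fin (k + 1) → Bool) =
            fun _ => false := by
          funext j; cases j <;> rfl
        rw [e]
        split_ifs with hq
        · rw [Finset.filter_false_of_mem]
          · have := two_pow_le_card_fiber (Sum.elim q.1.1 q.2.1)
            rw [Fintype.card_sum, Fintype.card_fin, ← two_mul] at this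
            simpa using this
          · intro y _ hy
            have h1 := hy (Sum.inl a)
            have h2 := hy (Sum.inr b)
            simp only [Sum.elim_inl, Sum.elim_inr] at h1 h2
            exact hab (by rw [← h1, ← h2, hq])
        · rw [zero_mul, add_zero]
          exact Nat.mul_le_mul_left _ (card_fiber_le _ _)

theorem sum_omega_mul_log_lt {k n : ℕ} (x : Fin (k + 1) → Bool) {a b : Fin (k + 1)}
    (hab : x a ≠ x b) (hn : 4 * (k + 1) ≤ n)
    (hlarge : 32 * (k + 1) ^ 3 * 8 ^ (k + 1) * (4 * (k + 1)) ^ (3 * k + 2) < √(n : ℝ)) :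
    ∑ y : Fin n → Bool, (omega x y : ℝ) * Real.log (omega x y) <
      ∑ y : Fin n → Bool, (omega (fun _ : Fin (k + 1) => false) y : ℝ) *
        Real.log (omega (fun _ : Fin (k + 1) => false) y) := by
  set L := n / (2 * (k + 1)) with hL
  have hLn : 2 * (k + 1) * L ≤ n := Nat.mul_div_le _ _
  have hLlow : (n : ℝ) ≤ 4 * (k + 1) * L := by
    have h1 : n < 2 * (k + 1) * (L + 1) := Nat.lt_mul_div_succ n (by positivity)
    have h2 : 4 * (k + 1) * 1 ≤ n := by omega
    have h3 : n ≤ 4 * (k + 1) * L := by nlinarith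
    exact_mod_cast h3
  have hn0 : 0 < n := by omega
  have hnR : (0 : ℝ) < n := by exact_mod_cast hn0
  have hs : 0 < √(n : ℝ) := by positivity
  have hs2 : √(n : ℝ) ^ 2 = n := Real.sq_sqrt hnR.le
  have hLpos : (0 : ℝ) < L := by
    by_contra! hcon
    nlinarith
  set μ : ℝ := (∑ y : Fin n → Bool, (omega (fun _ : Fin (k + 1) => false) y : ℝ)) / 2 ^ n with hμdef
  have hμL : (L : ℝ) ^ (k + 1) ≤ 2 ^ (k + 1) * μ := by
    have h1 := (Nat.mul_le_mul_right (2 ^ n) (pow_le_card_strictMonoMap k.succ_pos hLn)).trans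
      (card_strictMonoMap_mul_le (k + 1) n)
    rify at h1
    rw [hμdef, ← mul_div_assoc, le_div_iff₀ (by positivity)]
    exact h1
  have hμ : 0 < μ := by
    have : (0 : ℝ) < 2 ^ (k + 1) * μ := lt_of_lt_of_le (by positivity) hμL
    exact pos_of_mul_pos_right this (by positivity)
  have hmean : ∀ z : Fin (k + 1) → Bool, ∑ y : Fin n → Bool, ((omega z y : ℝ) - μ) = 0 := by
    intro z
    have h1 := sum_omega_eq (n := n) z
    rify at h1
    rw [Finset.sum_sub_distrib, h1, hμdef]
    simp
    field_simp
    simp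
  set c : ℝ := (k + 1) * n ^ k with hc
  have hcpos : 0 < c := by positivity
  have hT : ∀ z : Fin (k + 1) → Bool, ∑ y : Fin n → Bool, |(omega z y : ℝ) - μ| ^ 3 ≤
      2 * c ^ 3 * n * √n * 2 ^ n := fun z =>
    sum_abs_pow_three_le hcpos hn0 _
      (fun y i b => by simpa using abs_omega_update_sub_le z y i b) (hmean z)
  refine sum_mul_log_lt_of_sq_gap _ _ (fun _ => by positivity) (fun _ => by positivity) hμ
    (hmean x) (hmean _) (hT x) (hT _) ?_
  have hgap := sum_omega_sq_gap hLn x hab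
  rify at hgap
  set S₀ := ∑ y : Fin n → Bool, (omega (fun _ : Fin (k + 1) => false) y : ℝ) ^ 2
  set S₁ := ∑ y : Fin n → Bool, (omega x y : ℝ) ^ 2
  have hgap' : (L : ℝ) ^ (2 * k + 1) * 2 ^ n ≤ 2 ^ (2 * (k + 1)) * (S₀ - S₁) := by linarith
  have hprod := mul_le_mul hμL hgap' (by positivity) (by positivity)
  set K : ℝ := (4 * (k + 1)) ^ (3 * k + 2) with hK
  have hKpos : 0 < K := by positivity
  have hpowL : (n : ℝ) ^ (3 * k + 2) ≤ K * L ^ (3 * k + 2) := by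
    rw [hK, ← mul_pow]
    gcongr
  have h8 : (8 : ℝ) ^ (k + 1) = 2 ^ (k + 1) * 2 ^ (2 * (k + 1)) := by
    rw [pow_mul, ← mul_pow]; norm_num
  have hfin : 8 ^ (k + 1) * K * (16 * (2 * c ^ 3 * n * √n * 2 ^ n)) <
      8 ^ (k + 1) * K * (μ * (S₀ - S₁)) := by
    calc 8 ^ (k + 1) * K * (16 * (2 * c ^ 3 * n * √n * 2 ^ n))
        = (32 * (k + 1) ^ 3 * 8 ^ (k + 1) * K) * (√n * n * n ^ (3 * k) * 2 ^ n) := by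
          rw [hc]; ring
      _ < √n * (√n * n * n ^ (3 * k) * 2 ^ n) := by gcongr
      _ = √n ^ 2 * (n * n ^ (3 * k) * 2 ^ n) := by ring
      _ = n ^ (3 * k + 2) * 2 ^ n := by rw [hs2]; ring
      _ ≤ K * L ^ (3 * k + 2) * 2 ^ n := by gcongr
      _ = K * (L ^ (k + 1) * (L ^ (2 * k + 1) * 2 ^ n)) := by ring
      _ ≤ K * (2 ^ (k + 1) * μ * (2 ^ (2 * (k + 1)) * (S₀ - S₁))) := by gcongr
      _ = _ := by rw [h8]; ring
  exact lt_of_mul_lt_mul_left hfin (by positivity)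

end Auxiliary

/-- For every `m ≥ 1` there is an `N` such that for all `n > N` and every nonconstant
binary string `x` of length `m`,
`Σ_y ω_x(y) log₂ ω_x(y) < Σ_y ω_{0^m}(y) log₂ ω_{0^m}(y)`
(summands with `ω = 0` vanish since `Real.logb 2 0 = 0`): the constant strings uniquely
maximize `E[Ω_n log₂ Ω_n]` for large `n`. -/
theorem constant_maximizes_omega_log_omega (m : ℕ) (hm : 0 < m) :
    ∃ N : ℕ, ∀ n : ℕ, n > N → ∀ x : Fin m → Bool,
      (x ≠ fun _ => false) → (x ≠ fun _ => true) →
      ∑ y : Fin n → Bool, (omega x y : ℝ) * Real.logb 2 (omega x y : ℝ) <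
        ∑ y : Fin n → Bool,
          (omega (fun _ : Fin m => false) y : ℝ) *
            Real.logb 2 (omega (fun _ : Fin m => false) y : ℝ) := by
  obtain ⟨k, rfl⟩ := Nat.exists_eq_succ_of_ne_zero hm.ne'
  obtain ⟨N, hN⟩ := exists_nat_gt
    ((32 * ((k : ℝ) + 1) ^ 3 * 8 ^ (k + 1) * (4 * (k + 1)) ^ (3 * k + 2)) ^ 2)
  refine ⟨N + 4 * (k + 1), fun n hn x h0 h1 => ?_⟩
  obtain ⟨a, ha⟩ := Function.ne_iff.1 h0
  obtain ⟨b, hb⟩ := Function.ne_iff.1 h1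
  have hab : x a ≠ x b := by
    simp only [ne_eq, Bool.not_eq_false, Bool.not_eq_true] at ha hb
    simp [ha, hb]
  have hNn : (N : ℝ) ≤ n := by exact_mod_cast (by omega : N ≤ n)
  have h := sum_omega_mul_log_lt (n := n) x hab (by omega)
    (Real.lt_sqrt_of_sq_lt (hN.trans_le hNn))
  simp only [Real.logb, ← mul_div_assoc, ← Finset.sum_div]
  exact div_lt_div_of_pos_right h (Real.log_pos one_lt_two)
end
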